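/- (Quantitative L² lower bound) Fix Λ, M, η, d₀ > 0 and a positive integer m. Assume Ω has the uniform interior cone property and satisfies the broken-line condition with parameter m. There exist constants c > 0 and r* > 0, depending only on n, Ω, A, Λ, M, η, d₀ and m, such that: for every measurable q with ‖q‖_{L^∞(Ω)} ≤ Λ and every u ∈ C²(Ω) ∩ C¹(closure(Ω)) that is a classical solution of L_q u = 0 with ‖u‖_{C¹(closure(Ω))} ≤ M and |u(x)| ≥ η whenever x ∈ closure(Ω) and dist(x, ∂Ω) ≤ d₀, one has exp(−c e^{c/r}) ≤ (∫_{B(x,r) ∩ Ω} u(y)² dy)^{1/2} for every x ∈ closure(Ω) and every r with 0 < r ≤ r*. -/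

import Mathlib

open MeasureTheory Metric Set
open scoped RealInnerProductSpace

noncomputable section

/-- The `i`-th partial derivative of a real-valued function on `ℝⁿ`. -/
noncomputable def pd {n : ℕ} (i : Fin n) (f : EuclideanSpace ℝ (Fin n) → ℝ)
    (x : EuclideanSpace ℝ (Fin n)) : ℝ :=
  fderiv ℝ f x (EuclideanSpace.single i 1)

/-- `u` is a classical solution of `L_q u = ∑ᵢⱼ ∂ᵢ (aⁱʲ ∂ⱼ u) + q u = 0` pointwise in `Ω`. -/
def IsSolution {n : ℕ} (A : Fin n → Fin n → EuclideanSpace ℝ (Fin n) → ℝ)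
    (q u : EuclideanSpace ℝ (Fin n) → ℝ) (Ω : Set (EuclideanSpace ℝ (Fin n))) : Prop :=
  ∀ x ∈ Ω, (∑ i, ∑ j, pd i (fun y => A i j y * pd j u y) x) + q x * u x = 0

/-- The `H¹(D)` norm `(∫_D (w² + ‖∇w‖²))^{1/2}`. -/
noncomputable def H1Norm {n : ℕ} (D : Set (EuclideanSpace ℝ (Fin n)))
    (w : EuclideanSpace ℝ (Fin n) → ℝ) : ℝ :=
  (∫ x in D, ((w x) ^ 2 + ‖fderiv ℝ w x‖ ^ 2)) ^ (1 / 2 : ℝ)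

/-- `A = (aⁱʲ)` is symmetric, has `C¹` entries on `closure Ω`, and is uniformly elliptic. -/
def EllipticSym {n : ℕ} (Ω : Set (EuclideanSpace ℝ (Fin n)))
    (A : Fin n → Fin n → EuclideanSpace ℝ (Fin n) → ℝ) : Prop :=
  (∀ i j, ∀ x ∈ closure Ω, A i j x = A j i x) ∧
  (∀ i j, ContDiffOn ℝ 1 (A i j) (closure Ω)) ∧
  (∃ lam > 0, ∀ x ∈ Ω, ∀ ξ : EuclideanSpace ℝ (Fin n),
    lam * ‖ξ‖ ^ 2 ≤ ∑ i, ∑ j, A i j x * ξ i * ξ j)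

/-- Uniform interior cone property of `Ω`. -/
def UniformIntConeProperty {n : ℕ} (Ω : Set (EuclideanSpace ℝ (Fin n))) : Prop :=
  ∃ R > 0, ∃ θ₀ : ℝ, 0 < θ₀ ∧ θ₀ < Real.pi / 2 ∧
    ∀ xt ∈ frontier Ω, ∃ ξ : EuclideanSpace ℝ (Fin n), ‖ξ‖ = 1 ∧
      {x : EuclideanSpace ℝ (Fin n) |
        ‖x - xt‖ < 2 * R ∧ ‖x - xt‖ * Real.cos θ₀ < ⟪x - xt, ξ⟫} ⊆ Ω

/-- Any two points of `D` can be joined by a broken line in `D` with at most `m` segments. -/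
def BrokenLineCond {n : ℕ} (D : Set (EuclideanSpace ℝ (Fin n))) (m : ℕ) : Prop :=
  ∀ x ∈ D, ∀ y ∈ D, ∃ j ≤ m, ∃ z : ℕ → EuclideanSpace ℝ (Fin n),
    z 0 = x ∧ z j = y ∧ ∀ i < j, segment ℝ (z i) (z (i + 1)) ⊆ D

/-- `u ∈ C¹(closure Ω)` with `‖u‖_{C¹(closure Ω)} ≤ M`. -/
def C1BoundOn {n : ℕ} (Ω : Set (EuclideanSpace ℝ (Fin n)))
    (u : EuclideanSpace ℝ (Fin n) → ℝ) (M : ℝ) : Prop :=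
  ContDiffOn ℝ 1 u (closure Ω) ∧ (∀ x ∈ closure Ω, |u x| ≤ M) ∧
    ∀ x ∈ Ω, ‖fderiv ℝ u x‖ ≤ M



section pdcalc
variable {n : ℕ} {f g : EuclideanSpace ℝ (Fin n) → ℝ} {y : EuclideanSpace ℝ (Fin n)}

lemma pd_add' (i : Fin n) (hf : DifferentiableAt ℝ f y) (hg : DifferentiableAt ℝ g y) :
    pd i (fun x => f x + g x) y = pd i f y + pd i g y := by
  unfold pd
  rw [fderiv_fun_add hf hg]; rfl

lemma pd_sub' (i : Fin n) (hf : DifferentiableAt ℝ f y) (hg : DifferentiableAt ℝ g y) :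
    pd i (fun x => f x - g x) y = pd i f y - pd i g y := by
  unfold pd
  rw [fderiv_fun_sub hf hg]; rfl

lemma pd_mul' (i : Fin n) (hf : DifferentiableAt ℝ f y) (hg : DifferentiableAt ℝ g y) :
    pd i (fun x => f x * g x) y = pd i f y * g y + f y * pd i g y := by
  unfold pd
  rw [fderiv_fun_mul hf hg]
  simp
  ring

lemma pd_cmul' (i : Fin n) (c : ℝ) (hf : DifferentiableAt ℝ f y) :
    pd i (fun x => c * f x) y = c * pd i f y := by
  unfold pd
  rw [fderiv_const_mul hf]
  simp

lemma pd_sum' {ι : Type*} (s : Finset ι) (i : Fin n) {F : ι → EuclideanSpace ℝ (Fin n) → ℝ}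
    (hF : ∀ j ∈ s, DifferentiableAt ℝ (F j) y) :
    pd i (fun x => ∑ j ∈ s, F j x) y = ∑ j ∈ s, pd i (F j) y := by
  unfold pd
  rw [fderiv_fun_sum hF]
  simp

lemma pd_comp' (i : Fin n) {φ : ℝ → ℝ} {φ' : ℝ} (hφ : HasDerivAt φ φ' (f y))
    (hf : DifferentiableAt ℝ f y) :
    pd i (fun x => φ (f x)) y = φ' * pd i f y := by
  unfold pd
  have := (hφ.comp_hasFDerivAt y hf.hasFDerivAt).fderiv
  rw [show (fun x => φ (f x)) = φ ∘ f from rfl, this]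
  simp

lemma pd_congr' (i : Fin n) (h : f =ᶠ[nhds y] g) : pd i f y = pd i g y := by
  unfold pd
  rw [h.fderiv_eq]

lemma contDiffAt_pd {k m : ℕ∞} (i : Fin n) (hf : ContDiffAt ℝ m f y) (h : k + 1 ≤ m) :
    ContDiffAt ℝ k (pd i f) y := by
  unfold pd
  have h1 : ContDiffAt ℝ k (fderiv ℝ f) y := hf.fderiv_right (by exact_mod_cast h)
  exact h1.clm_apply contDiffAt_const

lemma pd_symm (i j : Fin n) (hf : ContDiffAt ℝ 2 f y) :
    pd i (pd j f) y = pd j (pd i f) y := by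
  have hs : IsSymmSndFDerivAt ℝ f y := hf.isSymmSndFDerivAt (by simp)
  have h1 : DifferentiableAt ℝ (fderiv ℝ f) y :=
    (hf.fderiv_right (m := 1) (by norm_num)).differentiableAt (by norm_num)
  unfold pd
  rw [fderiv_clm_apply h1 (differentiableAt_const _), fderiv_clm_apply h1 (differentiableAt_const _)]
  simpa using hs.eq _ _

end pdcalc

/-- flux `A ∇ w` -/
def flux {n : ℕ} (A : Fin n → Fin n → EuclideanSpace ℝ (Fin n) → ℝ)
    (w : EuclideanSpace ℝ (Fin n) → ℝ) (i : Fin n) (y : EuclideanSpace ℝ (Fin n)) : ℝ :=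
  ∑ j, A i j y * pd j w y

def Lop {n : ℕ} (A : Fin n → Fin n → EuclideanSpace ℝ (Fin n) → ℝ)
    (w : EuclideanSpace ℝ (Fin n) → ℝ) (y : EuclideanSpace ℝ (Fin n)) : ℝ :=
  ∑ i, ∑ j, pd i (fun y => A i j y * pd j w y) y

def Jf {n : ℕ} (A : Fin n → Fin n → EuclideanSpace ℝ (Fin n) → ℝ)
    (V : Fin n → EuclideanSpace ℝ (Fin n) → ℝ)
    (a g w : EuclideanSpace ℝ (Fin n) → ℝ) (τ : ℝ) (i : Fin n)
    (y : EuclideanSpace ℝ (Fin n)) : ℝ :=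
  (-4 * τ) * (flux A w i y * ∑ k, V k y * pd k w y)
  + (2 * τ) * (V i y * ∑ k, flux A w k y * pd k w y)
  + (-2 * τ) * ((g y * w y) * flux A w i y)
  + (-2 * τ ^ 3) * ((a y * V i y) * (w y * w y))

section ident
variable {n : ℕ} {A : Fin n → Fin n → EuclideanSpace ℝ (Fin n) → ℝ}
  {V : Fin n → EuclideanSpace ℝ (Fin n) → ℝ}
  {a g w : EuclideanSpace ℝ (Fin n) → ℝ} {τ : ℝ} {y : EuclideanSpace ℝ (Fin n)}

lemma div_flux (hA : ∀ i j, DifferentiableAt ℝ (A i j) y)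
    (hw : ContDiffAt ℝ 2 w y) : ∑ i, pd i (flux A w i) y = Lop A w y := by
  have hp : ∀ i, DifferentiableAt ℝ (pd i w) y := fun i =>
    (contDiffAt_pd (k := 1) (m := 2) i hw (by norm_num)).differentiableAt (by norm_num)
  unfold Lop
  refine Finset.sum_congr rfl fun i _ => ?_
  unfold flux
  rw [pd_sum' _ _ (fun j _ => (hA i j).fun_mul (hp j))]

lemma div_identity (hA : ∀ i j, DifferentiableAt ℝ (A i j) y)
    (hsym : ∀ i j, A i j y = A j i y)
    (hV : ∀ i, DifferentiableAt ℝ (V i) y) (ha : DifferentiableAt ℝ a y)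
    (hg : DifferentiableAt ℝ g y) (hw : ContDiffAt ℝ 2 w y) :
    ∑ i, pd i (Jf A V a g w τ i) y =
      2 * (Lop A w y + τ ^ 2 * a y * w y) * (-2 * τ * (∑ k, V k y * pd k w y) - τ * g y * w y)
      - (4 * τ * (∑ i, ∑ k, flux A w i y * pd i (V k) y * pd k w y)
        - 2 * τ * (∑ i, pd i (V i) y) * (∑ k, flux A w k y * pd k w y)
        - 2 * τ * (∑ k, V k y * ∑ i, ∑ j, pd k (A i j) y * pd i w y * pd j w y)
        + 2 * τ * (g y * (∑ k, flux A w k y * pd k w y) + w y * ∑ i, flux A w i y * pd i g y)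
        + 2 * τ ^ 3 * ((∑ i, pd i a y * V i y) + a y * (∑ i, pd i (V i) y) - a y * g y) * w y ^ 2)
      := by
  have hp : ∀ i, DifferentiableAt ℝ (pd i w) y := fun i =>
    (contDiffAt_pd (k := 1) (m := 2) i hw (by norm_num)).differentiableAt (by norm_num)
  have hwd : DifferentiableAt ℝ w y := hw.differentiableAt (by norm_num)
  have hfl : ∀ i, DifferentiableAt ℝ (flux A w i) y := by
    intro i; unfold flux
    exact DifferentiableAt.fun_sum fun j _ => (hA i j).fun_mul (hp j)
  have hVp : DifferentiableAt ℝ (fun y => ∑ k, V k y * pd k w y) y :=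
    DifferentiableAt.fun_sum fun j _ => (hV j).fun_mul (hp j)
  have hbp : DifferentiableAt ℝ (fun y => ∑ k, flux A w k y * pd k w y) y :=
    DifferentiableAt.fun_sum fun j _ => (hfl j).fun_mul (hp j)
  have hdf := div_flux hA hw
  have e1 : ∀ i, pd i (fun y => ∑ k, V k y * pd k w y) y
      = ∑ k, pd i (V k) y * pd k w y + ∑ k, V k y * pd i (pd k w) y := by
    intro i
    rw [pd_sum' _ _ (fun j _ => (hV j).fun_mul (hp j)), ← Finset.sum_add_distrib]
    exact Finset.sum_congr rfl fun k _ => pd_mul' i (hV k) (hp k)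
  have e2 : ∀ i, pd i (fun y => ∑ k, flux A w k y * pd k w y) y
      = (∑ k, ∑ j, pd i (A k j) y * pd k w y * pd j w y)
        + 2 * ∑ k, flux A w k y * pd i (pd k w) y := by
    intro i
    rw [pd_sum' _ _ (fun j _ => (hfl j).fun_mul (hp j))]
    have : ∀ k, pd i (fun y => flux A w k y * pd k w y) y
        = (∑ j, pd i (A k j) y * pd k w y * pd j w y)
          + (∑ j, A k j y * pd i (pd j w) y * pd k w y) + flux A w k y * pd i (pd k w) y := by
      intro k
      rw [pd_mul' i (hfl k) (hp k)]
      have : pd i (flux A w k) y = ∑ j, pd i (A k j) y * pd j w y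
          + ∑ j, A k j y * pd i (pd j w) y := by
        unfold flux
        rw [pd_sum' _ _ (fun j _ => (hA k j).fun_mul (hp j)), ← Finset.sum_add_distrib]
        exact Finset.sum_congr rfl fun j _ => pd_mul' i (hA k j) (hp j)
      rw [this, add_mul, Finset.sum_mul, Finset.sum_mul]
      congr 2
      exact Finset.sum_congr rfl fun j _ => by ring
    rw [Finset.sum_congr rfl fun k _ => this k, Finset.sum_add_distrib, Finset.sum_add_distrib]
    have h3 : ∑ k, ∑ j, A k j y * pd i (pd j w) y * pd k w y
        = ∑ k, flux A w k y * pd i (pd k w) y := by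
      rw [Finset.sum_comm]
      refine Finset.sum_congr rfl fun j _ => ?_
      unfold flux
      rw [Finset.sum_mul]
      refine Finset.sum_congr rfl fun k _ => ?_
      rw [hsym k j]; ring
    rw [h3]; ring
  have e3 : ∀ i, pd i (Jf A V a g w τ i) y =
      (-4 * τ) * (pd i (flux A w i) y * (∑ k, V k y * pd k w y)
        + flux A w i y * (∑ k, pd i (V k) y * pd k w y + ∑ k, V k y * pd i (pd k w) y))
      + (2 * τ) * (pd i (V i) y * (∑ k, flux A w k y * pd k w y)
        + V i y * ((∑ k, ∑ j, pd i (A k j) y * pd k w y * pd j w y)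
        + 2 * ∑ k, flux A w k y * pd i (pd k w) y))
      + (-2 * τ) * ((pd i g y * w y + g y * pd i w y) * flux A w i y
        + g y * w y * pd i (flux A w i) y)
      + (-2 * τ ^ 3) * ((pd i a y * V i y + a y * pd i (V i) y) * (w y * w y)
        + a y * V i y * (2 * w y * pd i w y)) := by
    intro i
    unfold Jf
    have d1 := (hfl i).fun_mul hVp
    have d2 := (hV i).fun_mul hbp
    have d3 := (hg.fun_mul hwd).fun_mul (hfl i)
    have d4 := (ha.fun_mul (hV i)).fun_mul (hwd.fun_mul hwd)
    rw [pd_add' i (((d1.const_mul _).fun_add (d2.const_mul _)).fun_add (d3.const_mul _)) (d4.const_mul _),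
      pd_add' i ((d1.const_mul _).fun_add (d2.const_mul _)) (d3.const_mul _),
      pd_add' i (d1.const_mul _) (d2.const_mul _),
      pd_cmul' i _ d1, pd_cmul' i _ d2, pd_cmul' i _ d3, pd_cmul' i _ d4,
      pd_mul' i (hfl i) hVp, pd_mul' i (hV i) hbp, pd_mul' i (hg.fun_mul hwd) (hfl i),
      pd_mul' i hg hwd, pd_mul' i (ha.fun_mul (hV i)) (hwd.fun_mul hwd),
      pd_mul' i ha (hV i), pd_mul' i hwd hwd, e1, e2]
    ring
  rw [Finset.sum_congr rfl fun i _ => e3 i]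
  have hc : ∑ i, flux A w i y * (∑ k, V k y * pd i (pd k w) y)
      = ∑ i, V i y * ∑ k, flux A w k y * pd i (pd k w) y := by
    simp_rw [Finset.mul_sum]
    rw [Finset.sum_comm]
    refine Finset.sum_congr rfl fun k _ => Finset.sum_congr rfl fun i _ => ?_
    rw [pd_symm i k hw]; ring
  have hc2 : (∑ i, ∑ k, flux A w i y * pd i (V k) y * pd k w y)
      = ∑ i, flux A w i y * ∑ k, pd i (V k) y * pd k w y := by
    simp_rw [Finset.mul_sum]
    refine Finset.sum_congr rfl fun k _ => Finset.sum_congr rfl fun i _ => ?_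
    ring
  have hc3 : (∑ k, flux A w k y * pd k w y) = ∑ k, pd k w y * flux A w k y :=
    Finset.sum_congr rfl fun k _ => by ring
  rw [hc2, ← hdf]
  have key : ∀ (Vp bp W G a0 : ℝ) (db b X1 X2 dV v X3 X4 dg p da : Fin n → ℝ),
      ∑ i, b i * X2 i = ∑ i, v i * X4 i → ∑ i, v i * p i = Vp → ∑ i, b i * p i = bp →
      ∑ i, ((-4 * τ) * (db i * Vp + b i * (X1 i + X2 i))
      + (2 * τ) * (dV i * bp + v i * (X3 i + 2 * X4 i))
      + (-2 * τ) * ((dg i * W + G * p i) * b i + G * W * db i)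
      + (-2 * τ ^ 3) * ((da i * v i + a0 * dV i) * (W * W) + a0 * v i * (2 * W * p i)))
      = 2 * (∑ i, db i + τ ^ 2 * a0 * W) * (-2 * τ * Vp - τ * G * W)
      - (4 * τ * (∑ i, b i * X1 i) - 2 * τ * (∑ i, dV i) * bp - 2 * τ * (∑ i, v i * X3 i)
        + 2 * τ * (G * bp + W * ∑ i, b i * dg i)
        + 2 * τ ^ 3 * ((∑ i, da i * v i) + a0 * (∑ i, dV i) - a0 * G) * W ^ 2) := by
    intro Vp bp W G a0 db b X1 X2 dV v X3 X4 dg p da h1 h2 h3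
    have : ∀ i, ((-4 * τ) * (db i * Vp + b i * (X1 i + X2 i))
      + (2 * τ) * (dV i * bp + v i * (X3 i + 2 * X4 i))
      + (-2 * τ) * ((dg i * W + G * p i) * b i + G * W * db i)
      + (-2 * τ ^ 3) * ((da i * v i + a0 * dV i) * (W * W) + a0 * v i * (2 * W * p i)))
      = (-4 * τ * Vp - 2 * τ * G * W) * db i + (-4 * τ) * (b i * X1 i) + (-4 * τ) * (b i * X2 i)
        + (2 * τ * bp - 2 * τ ^ 3 * a0 * W ^ 2) * dV i + (2 * τ) * (v i * X3 i)
        + (4 * τ) * (v i * X4 i) + (-2 * τ * W) * (b i * dg i) + (-2 * τ * G) * (b i * p i)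
        + (-2 * τ ^ 3 * W ^ 2) * (da i * v i) + (-4 * τ ^ 3 * a0 * W) * (v i * p i) := by
      intro i; ring
    rw [Finset.sum_congr rfl fun i _ => this i]
    simp only [Finset.sum_add_distrib, ← Finset.mul_sum]
    rw [h1, h2, h3]
    ring
  exact key _ _ _ _ _ _ _ _ _ _ _ _ _ _ _ _ hc rfl rfl
end ident


def rho {n : ℕ} (x y : EuclideanSpace ℝ (Fin n)) : ℝ := ∑ i, (y i - x i) * (y i - x i)

def bF {n : ℕ} (A : Fin n → Fin n → EuclideanSpace ℝ (Fin n) → ℝ) (x : EuclideanSpace ℝ (Fin n))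
    (i : Fin n) (y : EuclideanSpace ℝ (Fin n)) : ℝ := ∑ j, A i j y * (y j - x j)

def alF {n : ℕ} (A : Fin n → Fin n → EuclideanSpace ℝ (Fin n) → ℝ)
    (x y : EuclideanSpace ℝ (Fin n)) : ℝ := ∑ i, (y i - x i) * bF A x i y

def Jr {n : ℕ} (A : Fin n → Fin n → EuclideanSpace ℝ (Fin n) → ℝ) (x : EuclideanSpace ℝ (Fin n))
    (h m1 m2 : ℝ → ℝ) (w : EuclideanSpace ℝ (Fin n) → ℝ) (τ : ℝ) (i : Fin n)
    (y : EuclideanSpace ℝ (Fin n)) : ℝ :=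
  Jf A (fun k y => h (rho x y) * bF A x k y) (fun y => m1 (rho x y) * alF A x y)
    (fun y => m2 (rho x y) * alF A x y) w τ i y

section radial
variable {n : ℕ} {A : Fin n → Fin n → EuclideanSpace ℝ (Fin n) → ℝ}
  {x y : EuclideanSpace ℝ (Fin n)} {w u : EuclideanSpace ℝ (Fin n) → ℝ} {τ : ℝ}

lemma contDiff_coord (i : Fin n) {k : ℕ∞} :
    ContDiff ℝ k (fun y : EuclideanSpace ℝ (Fin n) => y i - x i) :=
  ((EuclideanSpace.proj (𝕜 := ℝ) i).contDiff).sub contDiff_const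

lemma diff_coord (i : Fin n) :
    DifferentiableAt ℝ (fun y : EuclideanSpace ℝ (Fin n) => y i - x i) y :=
  (contDiff_coord (k := 1) i).contDiffAt.differentiableAt (by norm_num)

lemma pd_coord (i j : Fin n) :
    pd i (fun y : EuclideanSpace ℝ (Fin n) => y j - x j) y = if i = j then 1 else 0 := by
  unfold pd
  have : HasFDerivAt (fun y : EuclideanSpace ℝ (Fin n) => y j - x j)
      (EuclideanSpace.proj (𝕜 := ℝ) j) y :=
    ((EuclideanSpace.proj (𝕜 := ℝ) j).hasFDerivAt).sub_const _
  rw [this.fderiv]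
  simp [eq_comm]

lemma contDiff_rho {k : ℕ∞} : ContDiff ℝ k (rho x) := by
  unfold rho
  exact ContDiff.sum fun i _ => (contDiff_coord i).mul (contDiff_coord i)

lemma diff_rho : DifferentiableAt ℝ (rho x) y :=
  (contDiff_rho (k := 1)).contDiffAt.differentiableAt (by norm_num)

lemma pd_rho (i : Fin n) : pd i (rho x) y = 2 * (y i - x i) := by
  unfold rho
  rw [pd_sum' _ _ (fun j _ => (diff_coord j).fun_mul (diff_coord j))]
  rw [Finset.sum_congr rfl fun j _ => pd_mul' i (diff_coord j) (diff_coord j)]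
  simp only [pd_coord]
  simp [Finset.sum_add_distrib]
  ring

lemma contDiffAt_bF {k : ℕ∞} (hA : ∀ i j, ContDiffAt ℝ k (A i j) y) (i : Fin n) :
    ContDiffAt ℝ k (bF A x i) y := by
  unfold bF
  exact ContDiffAt.sum fun j _ => (hA i j).mul (contDiff_coord j).contDiffAt

lemma contDiffAt_alF {k : ℕ∞} (hA : ∀ i j, ContDiffAt ℝ k (A i j) y) :
    ContDiffAt ℝ k (alF A x) y := by
  unfold alF
  exact ContDiffAt.sum fun j _ => (contDiff_coord j).contDiffAt.mul (contDiffAt_bF hA j)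

lemma pd_bF (hA : ∀ i j, ContDiffAt ℝ 1 (A i j) y) (k i : Fin n) :
    pd k (bF A x i) y = ∑ j, pd k (A i j) y * (y j - x j) + A i k y := by
  unfold bF
  have hA' : ∀ i j, DifferentiableAt ℝ (A i j) y := fun i j =>
    (hA i j).differentiableAt (by norm_num)
  rw [pd_sum' _ _ (fun j _ => (hA' i j).fun_mul (diff_coord j))]
  rw [Finset.sum_congr rfl fun j _ => pd_mul' k (hA' i j) (diff_coord j)]
  simp only [pd_coord]
  simp [Finset.sum_add_distrib]

lemma pd_alF (hA : ∀ i j, ContDiffAt ℝ 1 (A i j) y) (k : Fin n) :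
    pd k (alF A x) y = bF A x k y + ∑ i, (y i - x i) * pd k (bF A x i) y := by
  unfold alF
  have hb : ∀ i, DifferentiableAt ℝ (bF A x i) y := fun i =>
    (contDiffAt_bF hA i).differentiableAt (by norm_num)
  rw [pd_sum' _ _ (fun j _ => (diff_coord j).fun_mul (hb j))]
  rw [Finset.sum_congr rfl fun j _ => pd_mul' k (diff_coord j) (hb j)]
  simp only [pd_coord]
  simp [Finset.sum_add_distrib]

lemma sum_z_flux (hsym : ∀ i j, A i j y = A j i y) :
    ∑ i, flux A w i y * (y i - x i) = ∑ k, bF A x k y * pd k w y := by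
  unfold flux bF
  simp_rw [Finset.sum_mul]
  rw [Finset.sum_comm]
  refine Finset.sum_congr rfl fun k _ => Finset.sum_congr rfl fun i _ => ?_
  rw [hsym i k]; ring

lemma radial_identity (hA : ∀ i j, ContDiffAt ℝ 1 (A i j) y)
    (hsym : ∀ i j, A i j y = A j i y) (hw : ContDiffAt ℝ 2 w y)
    {h m1 m2 : ℝ → ℝ} {h' m1' m2' : ℝ} (hh : HasDerivAt h h' (rho x y))
    (hm1 : HasDerivAt m1 m1' (rho x y)) (hm2 : HasDerivAt m2 m2' (rho x y))
    {H N1 N2 α X B T1 T2 T3 T4 dv : ℝ} (eH : h (rho x y) = H) (eN1 : m1 (rho x y) = N1)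
    (eN2 : m2 (rho x y) = N2) (eα : alF A x y = α)
    (eX : ∑ k, flux A w k y * pd k w y = X)
    (eB : ∑ k, bF A x k y * pd k w y = B)
    (eT1 : ∑ i, ∑ k, flux A w i y * pd i (bF A x k) y * pd k w y = T1)
    (eT2 : ∑ k, bF A x k y * ∑ i, ∑ j, pd k (A i j) y * pd i w y * pd j w y = T2)
    (eT3 : ∑ i, pd i (alF A x) y * bF A x i y = T3)
    (eT4 : ∑ i, flux A w i y * pd i (alF A x) y = T4)
    (edv : ∑ i, pd i (bF A x i) y = dv) :
    ∑ i, pd i (Jr A x h m1 m2 w τ i) y =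
      2 * (Lop A w y + τ ^ 2 * (N1 * α) * w y) * (-2 * τ * (H * B) - τ * (N2 * α) * w y)
      - (4 * τ * (2 * h' * B ^ 2 + H * T1) - 2 * τ * (2 * h' * α + H * dv) * X
        - 2 * τ * (H * T2)
        + 2 * τ * (N2 * α * X + w y * (2 * m2' * α * B + N2 * T4))
        + 2 * τ ^ 3 * (H * (2 * m1' * α ^ 2 + N1 * T3) + N1 * α * (2 * h' * α + H * dv)
            - N1 * α * (N2 * α)) * w y ^ 2) := by
  have hA' : ∀ i j, DifferentiableAt ℝ (A i j) y := fun i j =>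
    (hA i j).differentiableAt (by norm_num)
  have hb : ∀ i, DifferentiableAt ℝ (bF A x i) y := fun i =>
    (contDiffAt_bF hA i).differentiableAt (by norm_num)
  have hal : DifferentiableAt ℝ (alF A x) y :=
    (contDiffAt_alF hA).differentiableAt (by norm_num)
  have dh : DifferentiableAt ℝ (fun y => h (rho x y)) y :=
    hh.differentiableAt.comp y diff_rho
  have dm1 : DifferentiableAt ℝ (fun y => m1 (rho x y)) y :=
    hm1.differentiableAt.comp y diff_rho
  have dm2 : DifferentiableAt ℝ (fun y => m2 (rho x y)) y :=
    hm2.differentiableAt.comp y diff_rho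
  have pV : ∀ i k, pd i (fun y => h (rho x y) * bF A x k y) y
      = 2 * h' * (y i - x i) * bF A x k y + H * pd i (bF A x k) y := by
    intro i k
    rw [pd_mul' i dh (hb k), pd_comp' i hh diff_rho, pd_rho, eH]; ring
  have pa : ∀ i, pd i (fun y => m1 (rho x y) * alF A x y) y
      = 2 * m1' * (y i - x i) * α + N1 * pd i (alF A x) y := by
    intro i
    rw [pd_mul' i dm1 hal, pd_comp' i hm1 diff_rho, pd_rho, eN1, eα]; ring
  have pg : ∀ i, pd i (fun y => m2 (rho x y) * alF A x y) y
      = 2 * m2' * (y i - x i) * α + N2 * pd i (alF A x) y := by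
    intro i
    rw [pd_mul' i dm2 hal, pd_comp' i hm2 diff_rho, pd_rho, eN2, eα]; ring
  unfold Jr
  rw [div_identity hA' hsym (fun k => dh.fun_mul (hb k)) (dm1.fun_mul hal) (dm2.fun_mul hal) hw]
  have s1 : ∑ k, h (rho x y) * bF A x k y * pd k w y = H * B := by
    rw [← eB, Finset.mul_sum, eH]
    exact Finset.sum_congr rfl fun k _ => by ring
  have s2 : ∑ i, ∑ k, flux A w i y * pd i (fun y => h (rho x y) * bF A x k y) y * pd k w y
      = 2 * h' * B ^ 2 + H * T1 := by
    have : ∀ i, ∑ k, flux A w i y * pd i (fun y => h (rho x y) * bF A x k y) y * pd k w y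
        = 2 * h' * B * (flux A w i y * (y i - x i))
          + H * ∑ k, flux A w i y * pd i (bF A x k) y * pd k w y := by
      intro i
      rw [← eB, Finset.mul_sum, Finset.mul_sum, Finset.sum_mul, ← Finset.sum_add_distrib]
      refine Finset.sum_congr rfl fun k _ => ?_
      rw [pV]; ring
    rw [Finset.sum_congr rfl fun i _ => this i, Finset.sum_add_distrib, ← Finset.mul_sum,
      ← Finset.mul_sum, sum_z_flux hsym, eB, eT1]
    ring
  have s3 : ∑ i, pd i (fun y => h (rho x y) * bF A x i y) y = 2 * h' * α + H * dv := by
    rw [← eα, ← edv]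
    unfold alF
    rw [Finset.mul_sum, Finset.mul_sum, ← Finset.sum_add_distrib]
    refine Finset.sum_congr rfl fun k _ => ?_
    rw [pV]; ring
  have s4 : ∑ k, h (rho x y) * bF A x k y * ∑ i, ∑ j, pd k (A i j) y * pd i w y * pd j w y
      = H * T2 := by
    rw [← eT2, Finset.mul_sum, eH]
    exact Finset.sum_congr rfl fun k _ => by ring
  have s5 : ∑ i, flux A w i y * pd i (fun y => m2 (rho x y) * alF A x y) y
      = 2 * m2' * α * B + N2 * T4 := by
    rw [← eT4, ← eB, ← sum_z_flux hsym, Finset.mul_sum, Finset.mul_sum, ← Finset.sum_add_distrib]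
    refine Finset.sum_congr rfl fun k _ => ?_
    rw [pg]; ring
  have s6 : ∑ i, pd i (fun y => m1 (rho x y) * alF A x y) y * (h (rho x y) * bF A x i y)
      = H * (2 * m1' * α ^ 2 + N1 * T3) := by
    have : ∀ i, pd i (fun y => m1 (rho x y) * alF A x y) y * (h (rho x y) * bF A x i y)
        = (H * 2 * m1' * α) * ((y i - x i) * bF A x i y)
          + (H * N1) * (pd i (alF A x) y * bF A x i y) := by
      intro i; rw [pa, eH]; ring
    rw [Finset.sum_congr rfl fun i _ => this i, Finset.sum_add_distrib, ← Finset.mul_sum,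
      ← Finset.mul_sum, eT3]
    have : ∑ i, (y i - x i) * bF A x i y = α := eα
    rw [this]; ring
  rw [s1, s2, s3, s4, s5, s6, eX, eN1, eN2, eα]

/-- the function `Φ(|y-x|²) u(y)` -/
def wF (x : EuclideanSpace ℝ (Fin n)) (Φ : ℝ → ℝ) (u : EuclideanSpace ℝ (Fin n) → ℝ)
    (y : EuclideanSpace ℝ (Fin n)) : ℝ := Φ (rho x y) * u y

lemma pd_wF {Φ : ℝ → ℝ} {Φ' : ℝ} (hΦ : HasDerivAt Φ Φ' (rho x y)) (hu : DifferentiableAt ℝ u y)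
    (i : Fin n) :
    pd i (wF x Φ u) y = 2 * Φ' * (y i - x i) * u y + Φ (rho x y) * pd i u y := by
  have dh : DifferentiableAt ℝ (fun y => Φ (rho x y)) y :=
    hΦ.differentiableAt.comp y diff_rho
  unfold wF
  rw [pd_mul' i dh hu, pd_comp' i hΦ diff_rho, pd_rho]
  ring

lemma Lop_wF (hA : ∀ i j, ContDiffAt ℝ 1 (A i j) y)
    (hsym : ∀ i j, A i j y = A j i y) (hu : ContDiffAt ℝ 2 u y)
    {Φ Φ1 : ℝ → ℝ} {Φ2 : ℝ} (hΦ : ∀ᶠ t in nhds (rho x y), HasDerivAt Φ (Φ1 t) t)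
    (hΦ1 : HasDerivAt Φ1 Φ2 (rho x y)) (hw : ContDiffAt ℝ 2 (wF x Φ u) y) :
    Lop A (wF x Φ u) y = Φ (rho x y) * Lop A u y
      + 4 * Φ1 (rho x y) * (∑ k, bF A x k y * pd k u y)
      + u y * (2 * Φ1 (rho x y) * (∑ i, pd i (bF A x i) y) + 4 * Φ2 * alF A x y) := by
  have hA' : ∀ i j, DifferentiableAt ℝ (A i j) y := fun i j =>
    (hA i j).differentiableAt (by norm_num)
  have hb : ∀ i, DifferentiableAt ℝ (bF A x i) y := fun i =>
    (contDiffAt_bF hA i).differentiableAt (by norm_num)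
  have hp : ∀ i, DifferentiableAt ℝ (pd i u) y := fun i =>
    (contDiffAt_pd (k := 1) (m := 2) i hu (by norm_num)).differentiableAt (by norm_num)
  have hud : DifferentiableAt ℝ u y := hu.differentiableAt (by norm_num)
  have hfl : ∀ i, DifferentiableAt ℝ (flux A u i) y := by
    intro i; unfold flux
    exact DifferentiableAt.fun_sum fun j _ => (hA' i j).fun_mul (hp j)
  have hev : ∀ᶠ z in nhds y, DifferentiableAt ℝ u z := by
    have := hu.eventually (by simp)
    filter_upwards [this] with z hz using hz.differentiableAt (by norm_num)
  have hev2 : ∀ᶠ z in nhds y, HasDerivAt Φ (Φ1 (rho x z)) (rho x z) :=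
    (diff_rho (x := x) (y := y)).continuousAt.eventually hΦ
  have dΦ : DifferentiableAt ℝ (fun y => Φ (rho x y)) y :=
    hΦ.self_of_nhds.differentiableAt.comp y diff_rho
  have dΦ1 : DifferentiableAt ℝ (fun y => Φ1 (rho x y)) y :=
    hΦ1.differentiableAt.comp y diff_rho
  have hfe : ∀ i, flux A (wF x Φ u) i =ᶠ[nhds y] fun z => Φ (rho x z) * flux A u i z
      + 2 * (Φ1 (rho x z) * (u z * bF A x i z)) := by
    intro i
    filter_upwards [hev, hev2] with z h1 h2
    unfold flux bF
    rw [Finset.mul_sum, Finset.mul_sum, Finset.mul_sum, Finset.mul_sum, ← Finset.sum_add_distrib]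
    refine Finset.sum_congr rfl fun j _ => ?_
    rw [pd_wF h2 h1]; ring
  rw [← div_flux hA' hw]
  have : ∀ i, pd i (flux A (wF x Φ u) i) y =
      Φ (rho x y) * pd i (flux A u i) y + (2 * Φ1 (rho x y)) * (flux A u i y * (y i - x i))
      + (4 * Φ2 * u y) * ((y i - x i) * bF A x i y) + (2 * Φ1 (rho x y)) * (bF A x i y * pd i u y)
      + (2 * Φ1 (rho x y) * u y) * pd i (bF A x i) y := by
    intro i
    have d2 := dΦ1.fun_mul (hud.fun_mul (hb i))
    rw [pd_congr' i (hfe i), pd_add' i (dΦ.fun_mul (hfl i)) (d2.const_mul _), pd_cmul' i _ d2,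
      pd_mul' i dΦ (hfl i), pd_mul' i dΦ1 (hud.fun_mul (hb i)), pd_mul' i hud (hb i),
      pd_comp' i hΦ.self_of_nhds diff_rho, pd_comp' i hΦ1 diff_rho, pd_rho]
    ring
  rw [Finset.sum_congr rfl fun i _ => this i]
  simp only [Finset.sum_add_distrib, ← Finset.mul_sum]
  rw [div_flux hA' hu, sum_z_flux hsym]
  unfold alF
  ring

end radial


set_option maxHeartbeats 1000000 in
lemma scalar_norm {lam C : ℝ} (hl : 0 < lam) (hC : 0 < C) : ∃ k : ℕ, 1 ≤ k ∧ ∀ K0 : ℝ, 0 < K0 →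
    ∃ T0 : ℝ, 0 < T0 ∧ ∀ T α y X T1 T2 T3 T4 B dv W : ℝ, T0 ≤ T → lam ≤ α → α ≤ C → 0 ≤ y →
      lam * y ≤ X → X ≤ C * y → |T1| ≤ C * y → |T2| ≤ C * y → |T3| ≤ C → T4 ^ 2 ≤ C * y →
      B ^ 2 ≤ C * y → |dv| ≤ C →
      2 * T ^ 2 * W ^ 2 * ((4 * k - 4 * k ^ 2) * α - 2 * k * dv) ^ 2 + K0 * W ^ 2 ≤
      T * (16 * k * (k + 1) * B ^ 2 - 8 * k * T1 + (8 * k ^ 2 - 8 * k) * (α * X) + 4 * k * (dv * X)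
        + 4 * k * T2)
      + W * T * (-32 * k ^ 2 * (k + 2) * α * B + 16 * k ^ 2 * T4)
      + 2 * T ^ 3 * W ^ 2 * ((16 * k ^ 4 + 48 * k ^ 3) * α ^ 2 - 8 * k ^ 3 * (T3 + α * dv)) := by
  obtain ⟨k, hk⟩ := exists_nat_ge (2 + (12 * C + 12 * C ^ 2 + 1) / lam ^ 2)
  have hl2 : 0 < lam ^ 2 := by positivity
  have hk2 : (2 : ℝ) ≤ k := by
    have : 0 ≤ (12 * C + 12 * C ^ 2 + 1) / lam ^ 2 := by positivity
    linarith
  have hk3 : 12 * C + 12 * C ^ 2 + 1 ≤ (k - 2) * lam ^ 2 := by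
    rw [← div_le_iff₀ hl2]; linarith
  have hk1 : 1 ≤ k := by
    have : (1 : ℝ) ≤ k := by linarith
    exact_mod_cast this
  refine ⟨k, hk1, fun K0 hK0 => ?_⟩
  generalize (k : ℝ) = κ at *
  set KK : ℝ := 128 * κ ^ 4 * C + C ^ 3 * (32 * κ ^ 2 * (κ + 2)) ^ 2 / 2 with hKK
  set EE : ℝ := (4 * κ ^ 2 * C + 4 * κ * C + 2 * κ * C) ^ 2 with hEE
  have hKK0 : 0 ≤ KK := by positivity
  have hEE0 : 0 ≤ EE := by positivity
  refine ⟨1 + KK + EE + K0, by positivity, ?_⟩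
  intro T α y X T1 T2 T3 T4 B dv W hT hα1 hα2 hy hX1 hX2 hT1 hT2 hT3 hT4 hB hdv
  have hT1' := abs_le.1 hT1
  have hT2' := abs_le.1 hT2
  have hT3' := abs_le.1 hT3
  have hdv' := abs_le.1 hdv
  have hαp : 0 < α := lt_of_lt_of_le hl hα1
  have hX0 : 0 ≤ X := le_trans (by positivity) hX1
  have hκ : 0 < κ := by linarith
  have hTp : 1 ≤ T := by linarith
  -- gradient part
  have g1 : lam ^ 2 * y ≤ α * X := by
    calc lam ^ 2 * y = lam * (lam * y) := by ring
      _ ≤ α * X := mul_le_mul hα1 hX1 (by positivity) hαp.le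
  have g2 : -(C ^ 2 * y) ≤ dv * X := by
    have : |dv * X| ≤ C * (C * y) := by
      rw [abs_mul, abs_of_nonneg hX0]
      exact mul_le_mul hdv hX2 hX0 hC.le
    have := (abs_le.1 this).1
    linarith
  have hgrad : y ≤ 16 * κ * (κ + 1) * B ^ 2 - 8 * κ * T1 + (8 * κ ^ 2 - 8 * κ) * (α * X)
      + 4 * κ * (dv * X) + 4 * κ * T2 := by
    have a1 : 0 ≤ 16 * κ * (κ + 1) * B ^ 2 := by positivity
    have a2 : 8 * κ * T1 ≤ 8 * κ * (C * y) := mul_le_mul_of_nonneg_left hT1'.2 (by positivity)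
    have a3 : 4 * κ * (-(C * y)) ≤ 4 * κ * T2 := mul_le_mul_of_nonneg_left hT2'.1 (by positivity)
    have a4 : 4 * κ * (-(C ^ 2 * y)) ≤ 4 * κ * (dv * X) :=
      mul_le_mul_of_nonneg_left g2 (by positivity)
    have a5 : (8 * κ ^ 2 - 8 * κ) * (lam ^ 2 * y) ≤ (8 * κ ^ 2 - 8 * κ) * (α * X) :=
      mul_le_mul_of_nonneg_left g1 (by nlinarith)
    have a6 : 8 * κ * (12 * C + 12 * C ^ 2 + 1) * y ≤ 8 * κ * ((κ - 2) * lam ^ 2) * y := by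
      gcongr
    have a7 : 8 * κ * ((κ - 2) * lam ^ 2) * y ≤ (8 * κ ^ 2 - 8 * κ) * (lam ^ 2 * y) := by
      have : 0 ≤ 8 * κ * lam ^ 2 * y := by positivity
      linarith
    have a8 : 0 ≤ κ * C * y := by positivity
    have a9 : 0 ≤ κ * C ^ 2 * y := by positivity
    have a10 : y ≤ κ * y := le_mul_of_one_le_left hy (by linarith)
    linarith
  -- cross part
  have hcr : -y - KK * W ^ 2 ≤ W * (-32 * κ ^ 2 * (κ + 2) * α * B + 16 * κ ^ 2 * T4) := by
    have b1 : -(y / 2) - 128 * κ ^ 4 * C * W ^ 2 ≤ W * (16 * κ ^ 2 * T4) := by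
      have e : 0 ≤ (T4 + 16 * κ ^ 2 * C * W) ^ 2 / (2 * C) := by positivity
      have e2 : (T4 + 16 * κ ^ 2 * C * W) ^ 2 / (2 * C)
        = T4 ^ 2 / (2 * C) + W * (16 * κ ^ 2 * T4) + 128 * κ ^ 4 * C * W ^ 2 := by
        field_simp; ring
      have e3 : T4 ^ 2 / (2 * C) ≤ y / 2 := by
        rw [div_le_div_iff₀ (by positivity) (by positivity)]; linarith
      linarith
    have b2 : -(y / 2) - C ^ 3 * (32 * κ ^ 2 * (κ + 2)) ^ 2 / 2 * W ^ 2 ≤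
        W * (-32 * κ ^ 2 * (κ + 2) * α * B) := by
      set m := 32 * κ ^ 2 * (κ + 2) with hm
      have e : 0 ≤ (B - m * α * C * W) ^ 2 / (2 * C) := by positivity
      have e2 : (B - m * α * C * W) ^ 2 / (2 * C)
        = B ^ 2 / (2 * C) + W * (-32 * κ ^ 2 * (κ + 2) * α * B) + C * α ^ 2 * m ^ 2 / 2 * W ^ 2 := by
        rw [hm]; field_simp; ring
      have e3 : B ^ 2 / (2 * C) ≤ y / 2 := by
        rw [div_le_div_iff₀ (by positivity) (by positivity)]; linarith
      have e4 : C * α ^ 2 * m ^ 2 / 2 * W ^ 2 ≤ C * C ^ 2 * m ^ 2 / 2 * W ^ 2 := by gcongr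
      have e5 : C * C ^ 2 * m ^ 2 / 2 * W ^ 2 = C ^ 3 * m ^ 2 / 2 * W ^ 2 := by ring
      linarith
    rw [hKK]
    linarith
  -- zero order
  have hz : 1 ≤ (16 * κ ^ 4 + 48 * κ ^ 3) * α ^ 2 - 8 * κ ^ 3 * (T3 + α * dv) := by
    have c1 : α * dv ≤ C ^ 2 := by
      have : |α * dv| ≤ C * C := by
        rw [abs_mul, abs_of_pos hαp]
        exact mul_le_mul hα2 hdv (abs_nonneg _) hC.le
      have := (abs_le.1 this).2
      linarith
    have c2 : lam ^ 2 ≤ α ^ 2 := by gcongr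
    have c3 : 16 * κ ^ 4 * lam ^ 2 ≤ 16 * κ ^ 4 * α ^ 2 := by gcongr
    have c4 : 8 * κ ^ 3 * (T3 + α * dv) ≤ 8 * κ ^ 3 * (C + C ^ 2) := by
      gcongr; exact hT3'.2
    have c5 : 0 ≤ 48 * κ ^ 3 * α ^ 2 := by positivity
    have c6 : κ ^ 3 * (12 * C + 12 * C ^ 2 + 1) ≤ κ ^ 3 * ((κ - 2) * lam ^ 2) := by gcongr
    have c7 : κ ^ 3 * ((κ - 2) * lam ^ 2) ≤ κ ^ 4 * lam ^ 2 := by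
      have : 0 ≤ κ ^ 3 * lam ^ 2 := by positivity
      linarith
    have c8 : 1 ≤ κ ^ 3 := one_le_pow₀ (by linarith)
    have c9 : 0 ≤ κ ^ 3 * C := by positivity
    have c10 : 0 ≤ κ ^ 3 * C ^ 2 := by positivity
    linarith
  have hE : ((4 * κ - 4 * κ ^ 2) * α - 2 * κ * dv) ^ 2 ≤ EE := by
    rw [hEE]
    apply sq_le_sq'
    · have : κ ^ 2 * α ≤ κ ^ 2 * C := by gcongr
      have : κ * dv ≤ κ * C := by gcongr; exact hdv'.2
      have : 0 ≤ κ * α := by positivity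
      have : 0 ≤ κ * C := by positivity
      linarith
    · have : κ * α ≤ κ * C := by gcongr
      have : κ * (-C) ≤ κ * dv := by gcongr; exact hdv'.1
      have : 0 ≤ κ ^ 2 * α := by positivity
      have : 0 ≤ κ ^ 2 * C := by positivity
      linarith
  have hW : 0 ≤ W ^ 2 := by positivity
  have f1 : T * y ≤ T * (16 * κ * (κ + 1) * B ^ 2 - 8 * κ * T1 + (8 * κ ^ 2 - 8 * κ) * (α * X)
      + 4 * κ * (dv * X) + 4 * κ * T2) := by gcongr
  have f2 : T * (-y - KK * W ^ 2) ≤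
      T * (W * (-32 * κ ^ 2 * (κ + 2) * α * B + 16 * κ ^ 2 * T4)) := by gcongr
  have f3 : 2 * T ^ 3 * W ^ 2 * 1 ≤ 2 * T ^ 3 * W ^ 2 *
      ((16 * κ ^ 4 + 48 * κ ^ 3) * α ^ 2 - 8 * κ ^ 3 * (T3 + α * dv)) := by gcongr
  have f4 : 2 * T ^ 2 * W ^ 2 * ((4 * κ - 4 * κ ^ 2) * α - 2 * κ * dv) ^ 2
      ≤ 2 * T ^ 2 * W ^ 2 * EE := by gcongr
  have f5 : (2 * T ^ 2 * EE + K0 + T * KK) * W ^ 2 ≤ (2 * T ^ 3) * W ^ 2 := by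
    refine mul_le_mul_of_nonneg_right ?_ hW
    have t1 : T ≤ T ^ 2 := le_self_pow₀ hTp two_ne_zero
    have t2 : 1 ≤ T ^ 2 := one_le_pow₀ hTp
    have t3 : T * KK ≤ T ^ 2 * KK := by gcongr
    have t4 : K0 ≤ T ^ 2 * K0 := le_mul_of_one_le_left hK0.le t2
    have t5 : T ^ 2 * (1 + KK + EE + K0) ≤ T ^ 2 * T := by gcongr
    have t6 : 0 ≤ T ^ 2 * KK := by positivity
    have t7 : 0 ≤ T ^ 2 * K0 := by positivity
    have t8 : T ^ 2 * T = T ^ 3 := by ring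
    linarith
  linarith

set_option maxHeartbeats 1000000 in
/-- The scalar Carleman inequality. -/
lemma scalar_main {lam C : ℝ} (hl : 0 < lam) (hC : 0 < C) : ∃ k : ℕ, 1 ≤ k ∧ ∀ K0 : ℝ, 0 < K0 →
    ∃ T0 : ℝ, 0 < T0 ∧ ∀ τ P ρ α p2 X T1 T2 T3 T4 B dv W Lw : ℝ, 0 < P → P * ρ = 1 →
      T0 ≤ τ * P ^ k → lam * ρ ≤ α → α ≤ C * ρ → 0 ≤ p2 →
      lam * p2 ≤ X → X ≤ C * p2 → |T1| ≤ C * p2 → |T2| ≤ C * p2 → |T3| ≤ C * ρ →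
      T4 ^ 2 ≤ C * (ρ * p2) → B ^ 2 ≤ C * (ρ * p2) → |dv| ≤ C →
      ∀ H h' N1 m1' N2 m2' : ℝ, H = -2 * k * P ^ (k + 1) → h' = 2 * k * (k + 1) * P ^ (k + 2) →
      N1 = 4 * k ^ 2 * P ^ (2 * k + 2) → m1' = -(8 * k ^ 2 * (k + 1) * P ^ (2 * k + 3)) →
      N2 = 8 * k ^ 2 * P ^ (k + 2) → m2' = -(8 * k ^ 2 * (k + 2) * P ^ (k + 3)) →
      K0 * P ^ 2 * W ^ 2 +
      (2 * (Lw + τ ^ 2 * (N1 * α) * W) * (-2 * τ * (H * B) - τ * (N2 * α) * W)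
      - (4 * τ * (2 * h' * B ^ 2 + H * T1) - 2 * τ * (2 * h' * α + H * dv) * X
        - 2 * τ * (H * T2)
        + 2 * τ * (N2 * α * X + W * (2 * m2' * α * B + N2 * T4))
        + 2 * τ ^ 3 * (H * (2 * m1' * α ^ 2 + N1 * T3) + N1 * α * (2 * h' * α + H * dv)
            - N1 * α * (N2 * α)) * W ^ 2))
      ≤ 2 * (Lw - 2 * τ * (H * B) + τ ^ 2 * (N1 * α) * W - τ * (2 * h' * α + H * dv) * W) ^ 2 := by
  obtain ⟨k, hk, hmain⟩ := scalar_norm hl hC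
  refine ⟨k, hk, fun K0 hK0 => ?_⟩
  obtain ⟨T0, hT0, hm⟩ := hmain K0 hK0
  refine ⟨T0, hT0, ?_⟩
  intro τ P ρ α p2 X T1 T2 T3 T4 B dv W Lw hP hPρ hT hα1 hα2 hp2 hX1 hX2 hT1 hT2 hT3 hT4 hB hdv
    H h' N1 m1' N2 m2' eH eh' eN1 em1 eN2 em2
  have hρ : ρ = P⁻¹ := by field_simp; linarith
  have hρ0 : 0 < ρ := by rw [hρ]; positivity
  have el : P * (lam * ρ) = lam := by linear_combination lam * hPρ
  have eC : P * (C * ρ) = C := by linear_combination C * hPρ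
  have key := hm (τ * P ^ k) (P * α) (ρ * p2) (ρ * X) (ρ * T1) (ρ * T2) (P * T3) T4 B dv W hT
    (by linarith [mul_le_mul_of_nonneg_left hα1 hP.le])
    (by linarith [mul_le_mul_of_nonneg_left hα2 hP.le]) (by positivity)
    (by linarith [mul_le_mul_of_nonneg_left hX1 hρ0.le])
    (by linarith [mul_le_mul_of_nonneg_left hX2 hρ0.le])
    (by rw [abs_mul, abs_of_pos hρ0]; linarith [mul_le_mul_of_nonneg_left hT1 hρ0.le])
    (by rw [abs_mul, abs_of_pos hρ0]; linarith [mul_le_mul_of_nonneg_left hT2 hρ0.le])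
    (by rw [abs_mul, abs_of_pos hP]; linarith [mul_le_mul_of_nonneg_left hT3 hP.le])
    hT4 hB hdv
  have key2 := mul_le_mul_of_nonneg_left key (sq_nonneg P)
  have e1 : H = -2 * k * (P ^ k * P) := by rw [eH]; ring
  have e2 : h' = 2 * k * (k + 1) * (P ^ k * P ^ 2) := by rw [eh']; ring
  have e3 : N1 = 4 * k ^ 2 * ((P ^ k) ^ 2 * P ^ 2) := by rw [eN1]; ring
  have e4 : m1' = -(8 * k ^ 2 * (k + 1) * ((P ^ k) ^ 2 * P ^ 3)) := by rw [em1]; ring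
  have e5 : N2 = 8 * k ^ 2 * (P ^ k * P ^ 2) := by rw [eN2]; ring
  have e6 : m2' = -(8 * k ^ 2 * (k + 2) * (P ^ k * P ^ 3)) := by rw [em2]; ring
  clear eH eh' eN1 em1 eN2 em2 key hm hmain
  set f := Lw - 2 * τ * (H * B) + τ ^ 2 * (N1 * α) * W - τ * (2 * h' * α + H * dv) * W with hf
  set S := Lw + τ ^ 2 * (N1 * α) * W with hS
  set K := -2 * τ * (H * B) - τ * (N2 * α) * W with hK
  set E := τ * (2 * h' * α + H * dv - N2 * α) * W with hE
  have s1 : S + K = f + E := by rw [hS, hK, hf, hE]; ring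
  have s2 : 2 * S * K ≤ 2 * f ^ 2 + 2 * E ^ 2 := by
    have : (S + K) ^ 2 = (f + E) ^ 2 := by rw [s1]
    nlinarith [sq_nonneg S, sq_nonneg K, sq_nonneg (f - E)]
  have hEe : 2 * E ^ 2 = P ^ 2 * (2 * (τ * P ^ k) ^ 2 * W ^ 2 *
      ((4 * k - 4 * k ^ 2) * (P * α) - 2 * k * dv) ^ 2) := by
    rw [hE, e1, e2, e5]; ring
  have hQ : P ^ 2 * (τ * P ^ k * (16 * k * (k + 1) * B ^ 2 - 8 * k * (ρ * T1)
        + (8 * k ^ 2 - 8 * k) * (P * α * (ρ * X)) + 4 * k * (dv * (ρ * X)) + 4 * k * (ρ * T2))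
      + W * (τ * P ^ k) * (-32 * k ^ 2 * (k + 2) * (P * α) * B + 16 * k ^ 2 * T4)
      + 2 * (τ * P ^ k) ^ 3 * W ^ 2 * ((16 * k ^ 4 + 48 * k ^ 3) * (P * α) ^ 2
        - 8 * k ^ 3 * (P * T3 + P * α * dv)))
      = (4 * τ * (2 * h' * B ^ 2 + H * T1) - 2 * τ * (2 * h' * α + H * dv) * X
        - 2 * τ * (H * T2)
        + 2 * τ * (N2 * α * X + W * (2 * m2' * α * B + N2 * T4))
        + 2 * τ ^ 3 * (H * (2 * m1' * α ^ 2 + N1 * T3) + N1 * α * (2 * h' * α + H * dv)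
            - N1 * α * (N2 * α)) * W ^ 2) := by
    rw [e1, e2, e3, e4, e5, e6, hρ]
    generalize P ^ k = Z
    field_simp
    ring
  rw [hQ] at key2
  linarith [key2, s2, hEe]


lemma abs_sum_le_card {n : ℕ} {f : Fin n → ℝ} {c : ℝ} (h : ∀ i, |f i| ≤ c) :
    |∑ i, f i| ≤ n * c := by
  calc |∑ i, f i| ≤ ∑ i, |f i| := Finset.abs_sum_le_sum_abs _ _
    _ ≤ ∑ _i : Fin n, c := Finset.sum_le_sum fun i _ => h i
    _ = n * c := by simp

lemma abs_le_sqrt_sum {n : ℕ} (f : Fin n → ℝ) (i : Fin n) : |f i| ≤ √(∑ j, f j * f j) := by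
  apply Real.abs_le_sqrt
  rw [sq]
  exact Finset.single_le_sum (f := fun j => f j * f j) (fun j _ => mul_self_nonneg _)
    (Finset.mem_univ i)

lemma rho_eq {n : ℕ} (x y : EuclideanSpace ℝ (Fin n)) : rho x y = ‖y - x‖ ^ 2 := by
  rw [EuclideanSpace.norm_sq_eq]
  unfold rho
  refine Finset.sum_congr rfl fun i _ => ?_
  simp [sq]

/-- bounds on the coefficients at a point -/
structure CoefBd {n : ℕ} (A : Fin n → Fin n → EuclideanSpace ℝ (Fin n) → ℝ) (lam N : ℝ)
    (y : EuclideanSpace ℝ (Fin n)) : Prop where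
  cd : ∀ i j, ContDiffAt ℝ 1 (A i j) y
  sym : ∀ i j, A i j y = A j i y
  bd : ∀ i j, |A i j y| ≤ N
  dbd : ∀ k i j, |pd k (A i j) y| ≤ N
  ell : ∀ ξ : EuclideanSpace ℝ (Fin n), lam * ‖ξ‖ ^ 2 ≤ ∑ i, ∑ j, A i j y * ξ i * ξ j

lemma T_bounds (n : ℕ) {N D : ℝ} (hN : 0 ≤ N) (hD : 0 ≤ D) : ∃ C > 0,
    ∀ (A : Fin n → Fin n → EuclideanSpace ℝ (Fin n) → ℝ) (lam : ℝ)
    (x y : EuclideanSpace ℝ (Fin n)) (w : EuclideanSpace ℝ (Fin n) → ℝ), CoefBd A lam N y →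
    rho x y ≤ D ^ 2 →
    lam * rho x y ≤ alF A x y ∧ alF A x y ≤ C * rho x y ∧
    lam * (∑ i, pd i w y * pd i w y) ≤ ∑ k, flux A w k y * pd k w y ∧
    ∑ k, flux A w k y * pd k w y ≤ C * (∑ i, pd i w y * pd i w y) ∧
    |∑ i, ∑ k, flux A w i y * pd i (bF A x k) y * pd k w y| ≤ C * (∑ i, pd i w y * pd i w y) ∧
    |∑ k, bF A x k y * ∑ i, ∑ j, pd k (A i j) y * pd i w y * pd j w y|
      ≤ C * (∑ i, pd i w y * pd i w y) ∧
    |∑ i, pd i (alF A x) y * bF A x i y| ≤ C * rho x y ∧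
    (∑ i, flux A w i y * pd i (alF A x) y) ^ 2 ≤ C * (rho x y * ∑ i, pd i w y * pd i w y) ∧
    (∑ k, bF A x k y * pd k w y) ^ 2 ≤ C * (rho x y * ∑ i, pd i w y * pd i w y) ∧
    |∑ i, pd i (bF A x i) y| ≤ C := by
  set N1 : ℝ := n * (N * D) + N with hN1
  set N2 : ℝ := n * N + n * N1 with hN2
  have hN10 : 0 ≤ N1 := by positivity
  have hN20 : 0 ≤ N2 := by positivity
  set C1 : ℝ := n * (n * N) with hC1
  set C3 : ℝ := n * (n * (n * N * N1)) with hC3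
  set C4 : ℝ := n * (n * N * D * (n * (n * N))) with hC4
  set C5 : ℝ := n * (N2 * (n * N)) with hC5
  have h1 : 0 ≤ C1 := by positivity
  have h3 : 0 ≤ C3 := by positivity
  have h4 : 0 ≤ C4 := by positivity
  have h5 : 0 ≤ C5 := by positivity
  refine ⟨C1 + C3 + C4 + C5 + C5 ^ 2 + C1 ^ 2 + n * N1 + 1, by positivity, ?_⟩
  intro A lam x y w hc hρ
  set C := C1 + C3 + C4 + C5 + C5 ^ 2 + C1 ^ 2 + n * N1 + 1 with hCdef
  have h6 : 0 ≤ C1 ^ 2 := by positivity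
  have h7 : 0 ≤ C5 ^ 2 := by positivity
  have h8 : 0 ≤ n * N1 := by positivity
  set p2 := ∑ i, pd i w y * pd i w y with hp2
  have hp20 : 0 ≤ p2 := Finset.sum_nonneg fun i _ => mul_self_nonneg _
  have hρ0 : 0 ≤ rho x y := Finset.sum_nonneg fun i _ => mul_self_nonneg _
  set s := √(rho x y) with hs
  set q := √p2 with hq
  have hs2 : s * s = rho x y := Real.mul_self_sqrt hρ0
  have hq2 : q * q = p2 := Real.mul_self_sqrt hp20
  have hs0 : 0 ≤ s := Real.sqrt_nonneg _
  have hq0 : 0 ≤ q := Real.sqrt_nonneg _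
  have hsD : s ≤ D := by
    rw [hs]; exact (Real.sqrt_le_left hD).2 hρ
  have hz : ∀ i, |y i - x i| ≤ s := fun i => abs_le_sqrt_sum (fun i => y i - x i) i
  have hp : ∀ i, |pd i w y| ≤ q := fun i => abs_le_sqrt_sum (fun i => pd i w y) i
  have hb : ∀ i, |bF A x i y| ≤ n * (N * s) := fun i => abs_sum_le_card fun j => by
    rw [abs_mul]; exact mul_le_mul (hc.bd i j) (hz j) (abs_nonneg _) hN
  have hfl : ∀ i, |flux A w i y| ≤ n * (N * q) := fun i => abs_sum_le_card fun j => by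
    rw [abs_mul]; exact mul_le_mul (hc.bd i j) (hp j) (abs_nonneg _) hN
  have hdb : ∀ k i, |pd k (bF A x i) y| ≤ N1 := fun k i => by
    rw [pd_bF hc.cd]
    refine (abs_add_le _ _).trans (add_le_add (abs_sum_le_card fun j => ?_) (hc.bd i k))
    rw [abs_mul]
    exact mul_le_mul (hc.dbd k i j) ((hz j).trans hsD) (abs_nonneg _) hN
  have hda : ∀ k, |pd k (alF A x) y| ≤ N2 * s := fun k => by
    rw [pd_alF hc.cd]
    have : |∑ i, (y i - x i) * pd k (bF A x i) y| ≤ n * (s * N1) := abs_sum_le_card fun j => by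
      rw [abs_mul]; exact mul_le_mul (hz j) (hdb k j) (abs_nonneg _) hs0
    refine (abs_add_le _ _).trans ((add_le_add (hb k) this).trans (le_of_eq ?_))
    rw [hN2]; ring
  have bB : |∑ k, bF A x k y * pd k w y| ≤ C1 * (s * q) := by
    refine (abs_sum_le_card (c := n * (N * s) * q) fun j => ?_).trans (le_of_eq ?_)
    · rw [abs_mul]; exact mul_le_mul (hb j) (hp j) (abs_nonneg _) (by positivity)
    · rw [hC1]; ring
  have bT4 : |∑ i, flux A w i y * pd i (alF A x) y| ≤ C5 * (s * q) := by
    refine (abs_sum_le_card (c := n * (N * q) * (N2 * s)) fun j => ?_).trans (le_of_eq ?_)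
    · rw [abs_mul]; exact mul_le_mul (hfl j) (hda j) (abs_nonneg _) (by positivity)
    · rw [hC5]; ring
  refine ⟨?_, ?_, ?_, ?_, ?_, ?_, ?_, ?_, ?_, ?_⟩
  · have := hc.ell (y - x)
    rw [← rho_eq] at this
    refine this.trans (le_of_eq ?_)
    unfold alF bF
    refine Finset.sum_congr rfl fun i _ => ?_
    rw [Finset.mul_sum]
    refine Finset.sum_congr rfl fun j _ => ?_
    simp; ring
  · have : |alF A x y| ≤ C1 * rho x y := by
      refine (abs_sum_le_card (c := s * (n * (N * s))) fun j => ?_).trans (le_of_eq ?_)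
      · rw [abs_mul]; exact mul_le_mul (hz j) (hb j) (abs_nonneg _) (by positivity)
      · rw [hC1, ← hs2]; ring
    refine (le_abs_self _).trans (this.trans (mul_le_mul_of_nonneg_right ?_ hρ0))
    linarith
  · have := hc.ell (WithLp.toLp 2 fun i => pd i w y)
    rw [EuclideanSpace.norm_sq_eq] at this
    have e : ∑ i, ‖(WithLp.toLp 2 fun i => pd i w y : EuclideanSpace ℝ (Fin n)) i‖ ^ 2 = p2 := by
      rw [hp2]
      refine Finset.sum_congr rfl fun i _ => ?_
      simp [sq]
    rw [e] at this
    refine this.trans (le_of_eq ?_)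
    unfold flux
    refine Finset.sum_congr rfl fun i _ => ?_
    rw [Finset.sum_mul]
    refine Finset.sum_congr rfl fun j _ => ?_
    simp; ring
  · have : |∑ k, flux A w k y * pd k w y| ≤ C1 * p2 := by
      refine (abs_sum_le_card (c := (n * (N * q)) * q) fun j => ?_).trans (le_of_eq ?_)
      · rw [abs_mul]; exact mul_le_mul (hfl j) (hp j) (abs_nonneg _) (by positivity)
      · rw [hC1, ← hq2]; ring
    refine (le_abs_self _).trans (this.trans (mul_le_mul_of_nonneg_right ?_ hp20))
    linarith
  · have : |∑ i, ∑ k, flux A w i y * pd i (bF A x k) y * pd k w y| ≤ C3 * p2 := by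
      refine (abs_sum_le_card (c := n * (n * (N * q) * N1 * q)) fun j =>
        abs_sum_le_card fun i => ?_).trans (le_of_eq ?_)
      · rw [abs_mul, abs_mul]
        exact mul_le_mul (mul_le_mul (hfl j) (hdb j i) (abs_nonneg _) (by positivity)) (hp i)
          (abs_nonneg _) (by positivity)
      · rw [hC3, ← hq2]; ring
    refine this.trans (mul_le_mul_of_nonneg_right ?_ hp20)
    linarith
  · have : |∑ k, bF A x k y * ∑ i, ∑ j, pd k (A i j) y * pd i w y * pd j w y| ≤ C4 * p2 := by
      refine (abs_sum_le_card (c := n * (N * D) * (n * (n * (N * q * q)))) fun k => ?_).trans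
        (le_of_eq ?_)
      · rw [abs_mul]
        refine mul_le_mul ((hb k).trans (by gcongr)) (abs_sum_le_card fun i =>
          abs_sum_le_card fun j => ?_) (abs_nonneg _) (by positivity)
        rw [abs_mul, abs_mul]
        exact mul_le_mul (mul_le_mul (hc.dbd k i j) (hp i) (abs_nonneg _) (by positivity)) (hp j)
          (abs_nonneg _) (by positivity)
      · rw [hC4, ← hq2]; ring
    refine this.trans (mul_le_mul_of_nonneg_right ?_ hp20)
    linarith
  · have : |∑ i, pd i (alF A x) y * bF A x i y| ≤ C5 * rho x y := by
      refine (abs_sum_le_card (c := (N2 * s) * (n * (N * s))) fun j => ?_).trans (le_of_eq ?_)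
      · rw [abs_mul]; exact mul_le_mul (hda j) (hb j) (abs_nonneg _) (by positivity)
      · rw [hC5, ← hs2]; ring
    refine this.trans (mul_le_mul_of_nonneg_right ?_ hρ0)
    linarith
  · rw [← sq_abs]
    calc _ ≤ (C5 * (s * q)) ^ 2 := by gcongr
      _ = C5 ^ 2 * (rho x y * p2) := by rw [← hs2, ← hq2]; ring
      _ ≤ _ := mul_le_mul_of_nonneg_right (by linarith) (by positivity)
  · rw [← sq_abs]
    calc _ ≤ (C1 * (s * q)) ^ 2 := by gcongr
      _ = C1 ^ 2 * (rho x y * p2) := by rw [← hs2, ← hq2]; ring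
      _ ≤ _ := mul_le_mul_of_nonneg_right (by linarith) (by positivity)
  · refine (abs_sum_le_card fun i => hdb i i).trans ?_
    linarith


lemma hasDerivAt_invpow (m : ℕ) {t : ℝ} (ht : t ≠ 0) :
    HasDerivAt (fun t : ℝ => (t⁻¹) ^ m) (-(m * (t⁻¹) ^ (m + 1))) t := by
  have := (hasDerivAt_inv ht).fun_pow m
  refine this.congr_deriv ?_
  rcases m with _ | m
  · simp
  · simp only [Nat.add_sub_cancel]
    rw [pow_succ (t⁻¹) (m + 1), pow_succ (t⁻¹) m]
    field_simp

/-- Carleman weighted cutoff. -/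
def Phi (k : ℕ) (τ : ℝ) (F : ℝ → ℝ) (t : ℝ) : ℝ := F t * Real.exp (τ * (t⁻¹) ^ k)

def Phi1 (k : ℕ) (τ : ℝ) (F F1 : ℝ → ℝ) (t : ℝ) : ℝ :=
  (F1 t + τ * (-(k * (t⁻¹) ^ (k + 1))) * F t) * Real.exp (τ * (t⁻¹) ^ k)

def hC (k : ℕ) (t : ℝ) : ℝ := -2 * k * (t⁻¹) ^ (k + 1)
def m1C (k : ℕ) (t : ℝ) : ℝ := 4 * k ^ 2 * (t⁻¹) ^ (2 * k + 2)
def m2C (k : ℕ) (t : ℝ) : ℝ := 8 * k ^ 2 * (t⁻¹) ^ (k + 2)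

lemma hasDerivAt_hC (k : ℕ) {t : ℝ} (ht : t ≠ 0) :
    HasDerivAt (hC k) (2 * k * (k + 1) * (t⁻¹) ^ (k + 2)) t := by
  have := (hasDerivAt_invpow (k + 1) ht).const_mul (-2 * (k : ℝ))
  refine this.congr_deriv ?_
  push_cast; ring

lemma hasDerivAt_m1C (k : ℕ) {t : ℝ} (ht : t ≠ 0) :
    HasDerivAt (m1C k) (-(8 * k ^ 2 * (k + 1) * (t⁻¹) ^ (2 * k + 3))) t := by
  have := (hasDerivAt_invpow (2 * k + 2) ht).const_mul (4 * (k : ℝ) ^ 2)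
  refine this.congr_deriv ?_
  push_cast; ring

lemma hasDerivAt_m2C (k : ℕ) {t : ℝ} (ht : t ≠ 0) :
    HasDerivAt (m2C k) (-(8 * k ^ 2 * (k + 2) * (t⁻¹) ^ (k + 3))) t := by
  have := (hasDerivAt_invpow (k + 2) ht).const_mul (8 * (k : ℝ) ^ 2)
  refine this.congr_deriv ?_
  push_cast; ring

lemma hasDerivAt_Phi (k : ℕ) (τ : ℝ) {F F1 : ℝ → ℝ} {t : ℝ} (ht : t ≠ 0)
    (hF : HasDerivAt F (F1 t) t) : HasDerivAt (Phi k τ F) (Phi1 k τ F F1 t) t := by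
  have := hF.fun_mul ((hasDerivAt_invpow k ht).const_mul τ).exp
  refine this.congr_deriv ?_
  unfold Phi1; ring

lemma hasDerivAt_Phi1 (k : ℕ) (τ : ℝ) {F F1 F2 : ℝ → ℝ} {t : ℝ} (ht : t ≠ 0)
    (hF : HasDerivAt F (F1 t) t) (hF1 : HasDerivAt F1 (F2 t) t) :
    HasDerivAt (Phi1 k τ F F1) ((F2 t + 2 * τ * (-(k * (t⁻¹) ^ (k + 1))) * F1 t
      + τ * (k * (k + 1) * (t⁻¹) ^ (k + 2)) * F t + τ ^ 2 * (k * (t⁻¹) ^ (k + 1)) ^ 2 * F t)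
      * Real.exp (τ * (t⁻¹) ^ k)) t := by
  have h1 := (((hasDerivAt_invpow (k + 1) ht).const_mul (k : ℝ)).fun_neg.const_mul τ).fun_mul hF
  have := (hF1.fun_add h1).fun_mul ((hasDerivAt_invpow k ht).const_mul τ).exp
  refine this.congr_deriv ?_
  push_cast; ring

lemma contDiffAt_Phi (k : ℕ) (τ : ℝ) {F : ℝ → ℝ} {t : ℝ} (ht : t ≠ 0) {m : ℕ∞}
    (hF : ContDiffAt ℝ m F t) : ContDiffAt ℝ m (Phi k τ F) t := by
  unfold Phi
  exact hF.mul (Real.contDiff_exp.contDiffAt.comp t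
    (contDiffAt_const.mul ((contDiffAt_inv ℝ ht).pow k)))

lemma contDiffAt_wF {n : ℕ} {x y : EuclideanSpace ℝ (Fin n)} {u : EuclideanSpace ℝ (Fin n) → ℝ}
    {Φ : ℝ → ℝ} {m : ℕ∞} (hΦ : ContDiffAt ℝ m Φ (rho x y)) (hu : ContDiffAt ℝ m u y) :
    ContDiffAt ℝ m (wF x Φ u) y := by
  unfold wF
  exact (hΦ.comp y contDiff_rho.contDiffAt).mul hu

set_option maxHeartbeats 1000000 in
lemma carleman_pt (n : ℕ) {lam N D : ℝ} (hl : 0 < lam) (hN : 0 ≤ N) (hD : 0 < D) :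
    ∃ k : ℕ, 1 ≤ k ∧ ∀ Λ : ℝ, 0 < Λ → ∃ C > 0, ∃ τ0 > 0, ∀ τ, τ0 ≤ τ →
    ∀ (A : Fin n → Fin n → EuclideanSpace ℝ (Fin n) → ℝ)
    (x y : EuclideanSpace ℝ (Fin n)) (u : EuclideanSpace ℝ (Fin n) → ℝ) (F F1 F2 : ℝ → ℝ),
    CoefBd A lam N y → 0 < rho x y → rho x y ≤ D ^ 2 → ContDiffAt ℝ 2 u y →
    |Lop A u y| ≤ Λ * |u y| → ContDiff ℝ 2 F → (∀ t, HasDerivAt F (F1 t) t) →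
    (∀ t, HasDerivAt F1 (F2 t) t) →
    ((rho x y)⁻¹) ^ 2 * (wF x (Phi k τ F) u y) ^ 2
      + ∑ i, pd i (Jr A x (hC k) (m1C k) (m2C k) (wF x (Phi k τ F) u) τ i) y
    ≤ C * Real.exp (τ * ((rho x y)⁻¹) ^ k) ^ 2 * (F1 (rho x y) ^ 2 + F2 (rho x y) ^ 2)
      * (u y ^ 2 + ∑ i, pd i u y * pd i u y) := by
  obtain ⟨C, hCp, hTb⟩ := T_bounds n hN hD.le
  obtain ⟨k, hk, hsc⟩ := scalar_main hl hCp
  refine ⟨k, hk, fun Λ hΛ => ?_⟩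
  obtain ⟨T0, hT0, hm⟩ := hsc (1 + 4 * Λ ^ 2 * D ^ 4) (by positivity)
  refine ⟨4 * (64 * C * D ^ 2 + 16 * C ^ 2 + 32 * C ^ 2 * D ^ 4), by positivity,
    T0 * (D ^ 2) ^ k, by positivity, ?_⟩
  intro τ hτ A x y u F F1 F2 hc hρ0 hρD hu hLu hFc hF hF1
  have hρne : rho x y ≠ 0 := hρ0.ne'
  set w := wF x (Phi k τ F) u with hw
  have hwc : ContDiffAt ℝ 2 w y :=
    contDiffAt_wF (m := 2) (contDiffAt_Phi (m := 2) k τ hρne hFc.contDiffAt) hu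
  have hΦev : ∀ᶠ t in nhds (rho x y), HasDerivAt (Phi k τ F) (Phi1 k τ F F1 t) t := by
    filter_upwards [isOpen_ne.mem_nhds hρne] with t ht using hasDerivAt_Phi k τ ht (hF t)
  have hL := Lop_wF (x := x) hc.cd hc.sym hu hΦev (hasDerivAt_Phi1 k τ hρne (hF _) (hF1 _)) hwc
  have hud : DifferentiableAt ℝ u y := hu.differentiableAt (by norm_num)
  obtain ⟨b1, b2, b3, b4, b5, b6, b7, b8, b9, b10⟩ := hTb A lam x y w hc hρD
  obtain ⟨-, -, -, -, -, -, -, -, bu, -⟩ := hTb A lam x y u hc hρD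
  have hid := radial_identity (x := x) (τ := τ) hc.cd hc.sym hwc (hasDerivAt_hC k hρne)
    (hasDerivAt_m1C k hρne) (hasDerivAt_m2C k hρne) rfl rfl rfl rfl rfl rfl rfl rfl rfl rfl rfl
  have hB : ∑ k, bF A x k y * pd k w y = 2 * Phi1 k τ F F1 (rho x y) * u y * alF A x y
      + Phi k τ F (rho x y) * ∑ k, bF A x k y * pd k u y := by
    unfold alF
    rw [Finset.mul_sum, Finset.mul_sum, ← Finset.sum_add_distrib]
    refine Finset.sum_congr rfl fun i _ => ?_
    rw [hw, pd_wF hΦev.self_of_nhds hud]; ring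
  have hwy : w y = Phi k τ F (rho x y) * u y := rfl
  set P := (rho x y)⁻¹ with hP
  have hP0 : 0 < P := inv_pos.2 hρ0
  have hPρ : P * rho x y = 1 := inv_mul_cancel₀ hρne
  have hPD : 1 ≤ P * D ^ 2 := by
    rw [← hPρ]; gcongr
  have hT : T0 ≤ τ * P ^ k := by
    calc T0 = T0 * 1 := by ring
      _ ≤ T0 * (P * D ^ 2) ^ k := by gcongr; exact one_le_pow₀ hPD
      _ = T0 * (D ^ 2) ^ k * P ^ k := by rw [mul_pow]; ring
      _ ≤ τ * P ^ k := by gcongr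
  have key := hm τ P (rho x y) (alF A x y) _ _ _ _ _ _ _ _ (w y) (Lop A w y) hP0 hPρ hT b1 b2
    (Finset.sum_nonneg fun i _ => mul_self_nonneg _) b3 b4 b5 b6 b7 b8 b9 b10
    (hC k (rho x y)) (2 * k * (k + 1) * P ^ (k + 2)) (m1C k (rho x y))
    (-(8 * k ^ 2 * (k + 1) * P ^ (2 * k + 3))) (m2C k (rho x y))
    (-(8 * k ^ 2 * (k + 2) * P ^ (k + 3))) rfl rfl rfl rfl rfl rfl
  rw [← hid] at key
  -- compute f
  set e := Real.exp (τ * P ^ k) with he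
  set dv := ∑ i, pd i (bF A x i) y with hdv
  set B0 := ∑ k, bF A x k y * pd k u y with hB0
  set α := alF A x y with hα
  set p2 := ∑ i, pd i u y * pd i u y with hp2
  have hp20 : 0 ≤ p2 := Finset.sum_nonneg fun i _ => mul_self_nonneg _
  set R := 4 * F1 (rho x y) * B0 + u y * (2 * F1 (rho x y) * dv + 4 * F2 (rho x y) * α) with hR
  have hf : Lop A w y - 2 * τ * (hC k (rho x y) * ∑ k, bF A x k y * pd k w y)
      + τ ^ 2 * (m1C k (rho x y) * α) * w y
      - τ * (2 * (2 * k * (k + 1) * P ^ (k + 2)) * α + hC k (rho x y) * dv) * w y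
      = e * (F (rho x y) * Lop A u y + R) := by
    rw [hL, hB, hwy, hR]
    unfold Phi Phi1 hC m1C
    rw [← hP, ← he]
    ring
  rw [hf] at key
  have hwe : w y = F (rho x y) * e * u y := by rw [hwy]; rfl
  have g1 : (F (rho x y) * Lop A u y) ^ 2 ≤ Λ ^ 2 * (F (rho x y) * u y) ^ 2 := by
    have : (Lop A u y) ^ 2 ≤ (Λ * |u y|) ^ 2 := by
      rw [← sq_abs (Lop A u y)]; gcongr
    rw [mul_pow, sq_abs] at this
    calc (F (rho x y) * Lop A u y) ^ 2 = F (rho x y) ^ 2 * (Lop A u y) ^ 2 := by ring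
      _ ≤ F (rho x y) ^ 2 * (Λ ^ 2 * u y ^ 2) := by gcongr
      _ = _ := by ring
  have g2 : 2 * (e * (F (rho x y) * Lop A u y + R)) ^ 2 ≤ 4 * Λ ^ 2 * (w y) ^ 2 + 4 * e ^ 2 * R ^ 2 := by
    have : (F (rho x y) * Lop A u y + R) ^ 2 ≤ 2 * (F (rho x y) * Lop A u y) ^ 2 + 2 * R ^ 2 := by
      nlinarith [sq_nonneg (F (rho x y) * Lop A u y - R)]
    calc 2 * (e * (F (rho x y) * Lop A u y + R)) ^ 2
        = 2 * e ^ 2 * (F (rho x y) * Lop A u y + R) ^ 2 := by ring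
      _ ≤ 2 * e ^ 2 * (2 * (Λ ^ 2 * (F (rho x y) * u y) ^ 2) + 2 * R ^ 2) := by
          gcongr; linarith
      _ = _ := by rw [hwe]; ring
  have g3 : 4 * Λ ^ 2 * (w y) ^ 2 ≤ 4 * Λ ^ 2 * D ^ 4 * P ^ 2 * w y ^ 2 := by
    have h1 : 1 ≤ (P * D ^ 2) ^ 2 := one_le_pow₀ hPD
    calc 4 * Λ ^ 2 * (w y) ^ 2 = 4 * Λ ^ 2 * (w y) ^ 2 * 1 := by ring
      _ ≤ 4 * Λ ^ 2 * (w y) ^ 2 * (P * D ^ 2) ^ 2 := by gcongr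
      _ = _ := by ring
  have hα0 : 0 ≤ α := le_trans (by positivity) b1
  have hα2 : α ^ 2 ≤ C ^ 2 * D ^ 4 := by
    calc α ^ 2 ≤ (C * D ^ 2) ^ 2 := by
          gcongr; exact b2.trans (by gcongr)
      _ = _ := by ring
  have hdv2 : dv ^ 2 ≤ C ^ 2 := by
    rw [← sq_abs]; gcongr
  have hB2 : B0 ^ 2 ≤ C * D ^ 2 * p2 := by
    calc B0 ^ 2 ≤ C * (rho x y * p2) := bu
      _ ≤ C * (D ^ 2 * p2) := by gcongr
      _ = _ := by ring
  have g4 : R ^ 2 ≤ (64 * C * D ^ 2 + 16 * C ^ 2 + 32 * C ^ 2 * D ^ 4)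
      * (F1 (rho x y) ^ 2 + F2 (rho x y) ^ 2) * (u y ^ 2 + p2) := by
    obtain ⟨a, ha⟩ : ∃ a, F1 (rho x y) = a := ⟨_, rfl⟩
    obtain ⟨b, hb⟩ : ∃ b, F2 (rho x y) = b := ⟨_, rfl⟩
    rw [ha, hb]
    have hR' : R ^ 2 ≤ a ^ 2 * (64 * B0 ^ 2 + 16 * (u y ^ 2 * dv ^ 2)) + 32 * b ^ 2 * (u y ^ 2 * α ^ 2) := by
      have : R = a * (4 * B0 + 2 * u y * dv) + b * (4 * u y * α) := by rw [hR, ha, hb]; ring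
      rw [this]
      have i1 : (a * (4 * B0 + 2 * u y * dv) + b * (4 * u y * α)) ^ 2 ≤
          2 * (a * (4 * B0 + 2 * u y * dv)) ^ 2 + 2 * (b * (4 * u y * α)) ^ 2 := by
        linarith [sq_nonneg (a * (4 * B0 + 2 * u y * dv) - b * (4 * u y * α))]
      have i2 : 0 ≤ a ^ 2 * (4 * B0 - 2 * u y * dv) ^ 2 := by positivity
      linarith
    calc R ^ 2 ≤ _ := hR'
      _ ≤ a ^ 2 * (64 * (C * D ^ 2 * p2) + 16 * (u y ^ 2 * C ^ 2))
          + 32 * b ^ 2 * (u y ^ 2 * (C ^ 2 * D ^ 4)) := by gcongr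
      _ ≤ _ := by
        have j1 : 0 ≤ a ^ 2 * (C * D ^ 2 * u y ^ 2) := by positivity
        have j2 : 0 ≤ a ^ 2 * (C ^ 2 * p2) := by positivity
        have j3 : 0 ≤ a ^ 2 * (C ^ 2 * D ^ 4 * (u y ^ 2 + p2)) := by positivity
        have j4 : 0 ≤ b ^ 2 * ((64 * C * D ^ 2 + 16 * C ^ 2) * (u y ^ 2 + p2)) := by positivity
        have j5 : 0 ≤ b ^ 2 * (C ^ 2 * D ^ 4 * p2) := by positivity
        linarith
  have g5 : 4 * e ^ 2 * R ^ 2 ≤ 4 * e ^ 2 * ((64 * C * D ^ 2 + 16 * C ^ 2 + 32 * C ^ 2 * D ^ 4)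
      * (F1 (rho x y) ^ 2 + F2 (rho x y) ^ 2) * (u y ^ 2 + p2)) := by gcongr
  linarith


lemma contDiff_of_off {n : ℕ} {J : EuclideanSpace ℝ (Fin n) → ℝ}
    {S : Set (EuclideanSpace ℝ (Fin n))} (hS : IsClosed S)
    (hJ : ∀ y ∈ S, ContDiffAt ℝ 1 J y) (h0 : ∀ y, y ∉ S → J y = 0) : ContDiff ℝ 1 J := by
  rw [contDiff_iff_contDiffAt]
  intro y
  by_cases hy : y ∈ S
  · exact hJ y hy
  · have : J =ᶠ[nhds y] fun _ => 0 := by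
      filter_upwards [hS.isOpen_compl.mem_nhds hy] with z hz using h0 z hz
    exact contDiffAt_const.congr_of_eventuallyEq this

lemma int_div_zero {n : ℕ} {J : Fin n → EuclideanSpace ℝ (Fin n) → ℝ}
    {S : Set (EuclideanSpace ℝ (Fin n))} (hS : IsCompact S)
    (hJ : ∀ i, ∀ y ∈ S, ContDiffAt ℝ 1 (J i) y) (h0 : ∀ i, ∀ y, y ∉ S → J i y = 0) :
    Integrable (fun y => ∑ i, pd i (J i) y) ∧ ∫ y, ∑ i, pd i (J i) y = 0 := by
  have hc : ∀ i, ContDiff ℝ 1 (J i) := fun i => contDiff_of_off hS.isClosed (hJ i) (h0 i)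
  have hcs : ∀ i, HasCompactSupport (J i) := fun i => HasCompactSupport.intro hS (h0 i)
  have hpc : ∀ i, Continuous (pd i (J i)) := fun i =>
    ((hc i).continuous_fderiv (by norm_num)).clm_apply continuous_const
  have hps : ∀ i, HasCompactSupport (pd i (J i)) := fun i => (hcs i).fderiv_apply ℝ _
  have hi : ∀ i, Integrable (pd i (J i)) := fun i =>
    (hpc i).integrable_of_hasCompactSupport (hps i)
  have hJi : ∀ i, Integrable (J i) := fun i =>
    (hc i).continuous.integrable_of_hasCompactSupport (hcs i)
  refine ⟨integrable_finsetSum _ fun i _ => hi i, ?_⟩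
  rw [integral_finsetSum _ fun i _ => hi i]
  refine Finset.sum_eq_zero fun i _ => ?_
  have := integral_mul_fderiv_eq_neg_fderiv_mul_of_integrable (μ := volume) (𝕜 := ℝ)
    (f := fun _ : EuclideanSpace ℝ (Fin n) => (1 : ℝ)) (g := J i)
    (v := EuclideanSpace.single i (1 : ℝ)) (by simp) (by simp only [one_mul]; exact hi i)
    (by simp only [one_mul]; exact hJi i) (fun x _ => differentiableAt_const _)
    (fun x _ => (hc i).differentiable (by norm_num) x)
  simpa [pd] using this

lemma pd_div_off {n : ℕ} {J : Fin n → EuclideanSpace ℝ (Fin n) → ℝ}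
    {S : Set (EuclideanSpace ℝ (Fin n))} (hS : IsClosed S)
    (h0 : ∀ i, ∀ y, y ∉ S → J i y = 0) {y : EuclideanSpace ℝ (Fin n)} (hy : y ∉ S) :
    ∑ i, pd i (J i) y = 0 := by
  refine Finset.sum_eq_zero fun i _ => ?_
  have : J i =ᶠ[nhds y] fun _ => 0 := by
    filter_upwards [hS.isOpen_compl.mem_nhds hy] with z hz using h0 i z hz
  rw [pd_congr' i this]
  simp [pd]

/-- bounds on the derivatives of the smooth transition. -/
lemma st_bounds : ∃ C : ℝ, 0 < C ∧ (∀ t, |deriv Real.smoothTransition t| ≤ C) ∧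
    ∀ t, |deriv (deriv Real.smoothTransition) t| ≤ C := by
  have key : ∀ f : ℝ → ℝ, Continuous f → (∀ t, t < 0 → f t = 0) → (∀ t, 1 < t → f t = 0) →
      ∃ C : ℝ, 0 < C ∧ ∀ t, |f t| ≤ C := by
    intro f hf h0 h1
    obtain ⟨C, hC⟩ := (isCompact_Icc (a := (0:ℝ)) (b := 1)).exists_bound_of_continuousOn hf.continuousOn
    refine ⟨max C 1, by positivity, fun t => ?_⟩
    by_cases ht : t ∈ Icc (0:ℝ) 1
    · exact (hC t ht).trans (le_max_left _ _)
    · have : f t = 0 := by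
        rcases lt_or_ge t 0 with h | h
        · exact h0 t h
        · exact h1 t (by by_contra h'; exact ht ⟨h, not_lt.1 h'⟩)
      rw [this]; simp
  have c2 : ContDiff ℝ 2 Real.smoothTransition := Real.smoothTransition.contDiff (n := 2)
  have d1 : ContDiff ℝ 1 (deriv Real.smoothTransition) := c2.deriv'
  have z0 : ∀ t, t < 0 → deriv Real.smoothTransition t = 0 := fun t ht => by
    have : Real.smoothTransition =ᶠ[nhds t] fun _ => 0 := by
      filter_upwards [isOpen_Iio.mem_nhds ht] with s hs
      exact Real.smoothTransition.zero_of_nonpos (le_of_lt hs)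
    rw [this.deriv_eq]; simp
  have z1 : ∀ t, 1 < t → deriv Real.smoothTransition t = 0 := fun t ht => by
    have : Real.smoothTransition =ᶠ[nhds t] fun _ => 1 := by
      filter_upwards [isOpen_Ioi.mem_nhds ht] with s hs
      exact Real.smoothTransition.one_of_one_le (le_of_lt hs)
    rw [this.deriv_eq]; simp
  obtain ⟨C1, hC1, h1⟩ := key _ d1.continuous z0 z1
  obtain ⟨C2, hC2, h2⟩ := key (deriv (deriv Real.smoothTransition))
    (d1.continuous_deriv (by norm_num)) (fun t ht => by
      have : deriv Real.smoothTransition =ᶠ[nhds t] fun _ => 0 := by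
        filter_upwards [isOpen_Iio.mem_nhds ht] with s hs using z0 s hs
      rw [this.deriv_eq]; simp) (fun t ht => by
      have : deriv Real.smoothTransition =ᶠ[nhds t] fun _ => 0 := by
        filter_upwards [isOpen_Ioi.mem_nhds ht] with s hs using z1 s hs
      rw [this.deriv_eq]; simp)
  exact ⟨max C1 C2, by positivity, fun t => (h1 t).trans (le_max_left _ _),
    fun t => (h2 t).trans (le_max_right _ _)⟩

/-- affine transition function. -/
def stA (c s t : ℝ) : ℝ := Real.smoothTransition ((t - c) / s)

lemma stA_cd (c s : ℝ) : ContDiff ℝ 3 (stA c s) := by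
  unfold stA
  exact (Real.smoothTransition.contDiff (n := 3)).comp
    ((contDiff_id.sub contDiff_const).div_const _)

lemma stA_deriv (c s t : ℝ) :
    deriv (stA c s) t = s⁻¹ * deriv Real.smoothTransition ((t - c) / s) := by
  have h1 : HasDerivAt (fun t : ℝ => (t - c) / s) (1 / s) t :=
    ((hasDerivAt_id t).sub_const c).div_const s
  have h2 : HasDerivAt Real.smoothTransition (deriv Real.smoothTransition ((t - c) / s))
      ((t - c) / s) := ((Real.smoothTransition.contDiff (n := 1)).differentiable
        (by norm_num) _).hasDerivAt
  have := (h2.comp t h1).deriv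
  have e : stA c s = Real.smoothTransition ∘ fun t => (t - c) / s := rfl
  rw [e, this]; ring

lemma stA_deriv2 (c s t : ℝ) :
    deriv (deriv (stA c s)) t = (s⁻¹) ^ 2 * deriv (deriv Real.smoothTransition) ((t - c) / s) := by
  have h1 : HasDerivAt (fun t : ℝ => (t - c) / s) (1 / s) t :=
    ((hasDerivAt_id t).sub_const c).div_const s
  have c2 : ContDiff ℝ 2 Real.smoothTransition := Real.smoothTransition.contDiff (n := 2)
  have d1 : ContDiff ℝ 1 (deriv Real.smoothTransition) := c2.deriv'
  have h2 : HasDerivAt (deriv Real.smoothTransition)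
      (deriv (deriv Real.smoothTransition) ((t - c) / s))
      ((t - c) / s) := (d1.differentiable (by norm_num) _).hasDerivAt
  have := ((h2.comp t h1).const_mul s⁻¹).deriv
  have e : deriv (stA c s) = fun t => s⁻¹ * ((deriv Real.smoothTransition ∘ fun t => (t - c) / s) t) := by
    funext t; exact stA_deriv c s t
  rw [e, this]; ring

lemma cutoff : ∃ C : ℝ, 0 < C ∧ ∀ a b b' : ℝ, 0 < a → 2 * a < b' → b' < b →
    ∃ F F1 F2 : ℝ → ℝ, ContDiff ℝ 2 F ∧ (∀ t, HasDerivAt F (F1 t) t) ∧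
      (∀ t, HasDerivAt F1 (F2 t) t) ∧ (∀ t, t ≤ a → F t = 0) ∧ (∀ t, b ≤ t → F t = 0) ∧
      (∀ t, 2 * a ≤ t → t ≤ b' → F t = 1) ∧
      (∀ t, 2 * a < t → t < b' → F1 t = 0 ∧ F2 t = 0) ∧
      (∀ t, t ≤ 2 * a → F1 t ^ 2 + F2 t ^ 2 ≤ C * ((a⁻¹) ^ 2 + (a⁻¹) ^ 4)) ∧
      (∀ t, b' ≤ t → F1 t ^ 2 + F2 t ^ 2 ≤ C * (((b - b')⁻¹) ^ 2 + ((b - b')⁻¹) ^ 4)) := by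
  obtain ⟨C, hC, h1, h2⟩ := st_bounds
  refine ⟨C ^ 2, by positivity, fun a b b' ha hab hbb => ?_⟩
  have hs : 0 < b - b' := by linarith
  set F : ℝ → ℝ := fun t => stA a a t * stA b (-(b - b')) t with hF
  have hF3 : ContDiff ℝ 3 F := (stA_cd _ _).mul (stA_cd _ _)
  have hF1c : ContDiff ℝ 2 (deriv F) := hF3.deriv'
  have f0 : ∀ t, t ≤ a → stA a a t = 0 := fun t ht =>
    Real.smoothTransition.zero_of_nonpos (div_nonpos_of_nonpos_of_nonneg (by linarith) ha.le)
  have f1 : ∀ t, 2 * a ≤ t → stA a a t = 1 := fun t ht =>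
    Real.smoothTransition.one_of_one_le (by rw [le_div_iff₀ ha]; linarith)
  have g0 : ∀ t, b ≤ t → stA b (-(b - b')) t = 0 := fun t ht =>
    Real.smoothTransition.zero_of_nonpos (div_nonpos_of_nonneg_of_nonpos (by linarith) (by linarith))
  have g1 : ∀ t, t ≤ b' → stA b (-(b - b')) t = 1 := fun t ht =>
    Real.smoothTransition.one_of_one_le (by rw [div_neg, ← neg_div, le_div_iff₀ hs]; linarith)
  have bnd : ∀ c s t : ℝ, deriv (stA c s) t ^ 2 + deriv (deriv (stA c s)) t ^ 2
      ≤ C ^ 2 * ((s⁻¹) ^ 2 + (s⁻¹) ^ 4) := by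
    intro c s t
    rw [stA_deriv, stA_deriv2, mul_pow, mul_pow, ← sq_abs (deriv Real.smoothTransition _),
      ← sq_abs (deriv (deriv Real.smoothTransition) _)]
    calc _ ≤ (s⁻¹) ^ 2 * C ^ 2 + ((s⁻¹) ^ 2) ^ 2 * C ^ 2 := by
          gcongr
          · exact h1 _
          · exact h2 _
      _ = _ := by ring
  refine ⟨F, deriv F, deriv (deriv F), hF3.of_le (by norm_num),
    fun t => (hF3.differentiable (by norm_num) t).hasDerivAt,
    fun t => (hF1c.differentiable (by norm_num) t).hasDerivAt,
    fun t ht => by simp [hF, f0 t ht], fun t ht => by simp [-neg_sub, hF, g0 t ht],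
    fun t ht ht' => by simp [-neg_sub, hF, f1 t ht, g1 t ht'], ?_, ?_, ?_⟩
  · intro t ht ht'
    have e : F =ᶠ[nhds t] fun _ => 1 := by
      filter_upwards [isOpen_Ioo.mem_nhds (show t ∈ Ioo (2 * a) b' from ⟨ht, ht'⟩)] with s hs
      simp [-neg_sub, hF, f1 s hs.1.le, g1 s hs.2.le]
    refine ⟨by rw [e.deriv_eq]; simp, by rw [e.deriv.deriv_eq]; simp⟩
  · intro t ht
    have e : F =ᶠ[nhds t] stA a a := by
      filter_upwards [isOpen_Iio.mem_nhds (show t ∈ Iio b' from lt_of_le_of_lt ht hab)] with s hs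
      simp [-neg_sub, hF, g1 s (le_of_lt hs)]
    rw [e.deriv_eq, e.deriv.deriv_eq]
    exact bnd _ _ _
  · intro t ht
    have e : F =ᶠ[nhds t] stA b (-(b - b')) := by
      filter_upwards [isOpen_Ioi.mem_nhds (show t ∈ Ioi (2 * a) from lt_of_lt_of_le hab ht)] with s hs
      simp [-neg_sub, hF, f1 s (le_of_lt hs)]
    rw [e.deriv_eq, e.deriv.deriv_eq]
    refine (bnd _ _ _).trans (le_of_eq ?_)
    rw [inv_neg]; ring

lemma cutoff2 : ∃ C : ℝ, 0 < C ∧ ∀ a : ℝ, 0 < a →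
    ∃ Z Z1 : ℝ → ℝ, ContDiff ℝ 1 Z ∧ (∀ t, HasDerivAt Z (Z1 t) t) ∧
      (∀ t, t ≤ 2 * a → Z t = 1) ∧ (∀ t, 4 * a ≤ t → Z t = 0) ∧ (∀ t, Z t ^ 2 ≤ 1) ∧
      (∀ t, Z1 t ^ 2 ≤ C * (a⁻¹) ^ 2) := by
  obtain ⟨C, hC, h1, h2⟩ := st_bounds
  refine ⟨C ^ 2, by positivity, fun a ha => ?_⟩
  refine ⟨stA (4 * a) (-(2 * a)), deriv (stA (4 * a) (-(2 * a))), (stA_cd _ _).of_le (by norm_num),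
    fun t => ((stA_cd _ _).differentiable (by norm_num) t).hasDerivAt, fun t ht =>
    Real.smoothTransition.one_of_one_le (by rw [div_neg, ← neg_div, le_div_iff₀ (by positivity)]; linarith),
    fun t ht => Real.smoothTransition.zero_of_nonpos
      (div_nonpos_of_nonneg_of_nonpos (by linarith) (by linarith)),
    fun t => pow_le_one₀ (Real.smoothTransition.nonneg _) (Real.smoothTransition.le_one _), ?_⟩
  intro t
  rw [stA_deriv, mul_pow, ← sq_abs (deriv Real.smoothTransition _), inv_neg, mul_inv]
  calc _ ≤ (-(2⁻¹ * a⁻¹)) ^ 2 * C ^ 2 := by gcongr; exact h1 _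
    _ = 4⁻¹ * (C ^ 2 * (a⁻¹) ^ 2) := by ring
    _ ≤ _ := by
      have : 0 ≤ C ^ 2 * (a⁻¹) ^ 2 := by positivity
      linarith

section cacc
variable {n : ℕ} {A : Fin n → Fin n → EuclideanSpace ℝ (Fin n) → ℝ}
  {x y : EuclideanSpace ℝ (Fin n)} {w u : EuclideanSpace ℝ (Fin n) → ℝ} {τ : ℝ}

def J2 (A : Fin n → Fin n → EuclideanSpace ℝ (Fin n) → ℝ) (x : EuclideanSpace ℝ (Fin n))
    (Z : ℝ → ℝ) (u : EuclideanSpace ℝ (Fin n) → ℝ) (i : Fin n)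
    (y : EuclideanSpace ℝ (Fin n)) : ℝ := (Z (rho x y) * Z (rho x y)) * (u y * flux A u i y)

lemma contDiffAt_flux (hA : ∀ i j, ContDiffAt ℝ 1 (A i j) y) (hu : ContDiffAt ℝ 2 u y) (i : Fin n) :
    ContDiffAt ℝ 1 (flux A u i) y := by
  unfold flux
  exact ContDiffAt.sum fun j _ => (hA i j).mul (contDiffAt_pd (k := 1) (m := 2) j hu (by norm_num))

lemma contDiffAt_J2 (hA : ∀ i j, ContDiffAt ℝ 1 (A i j) y) (hu : ContDiffAt ℝ 2 u y)
    {Z : ℝ → ℝ} (hZ : ContDiff ℝ 1 Z) (i : Fin n) : ContDiffAt ℝ 1 (J2 A x Z u i) y := by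
  have h1 : ContDiffAt ℝ 1 (fun y => Z (rho x y)) y :=
    (hZ.comp (contDiff_rho (k := 1))).contDiffAt
  unfold J2
  exact (h1.mul h1).mul ((hu.of_le (by norm_num)).mul (contDiffAt_flux hA hu i))

lemma contDiffAt_Jr (hA : ∀ i j, ContDiffAt ℝ 1 (A i j) y) (hw : ContDiffAt ℝ 2 w y)
    {h m1 m2 : ℝ → ℝ} (hh : ContDiffAt ℝ 1 h (rho x y)) (hm1 : ContDiffAt ℝ 1 m1 (rho x y))
    (hm2 : ContDiffAt ℝ 1 m2 (rho x y)) (i : Fin n) :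
    ContDiffAt ℝ 1 (Jr A x h m1 m2 w τ i) y := by
  have hr : ContDiffAt ℝ 1 (rho x) y := (contDiff_rho (k := 1)).contDiffAt
  have hh' : ContDiffAt ℝ 1 (fun y => h (rho x y)) y := hh.comp y hr
  have hm1' : ContDiffAt ℝ 1 (fun y => m1 (rho x y)) y := hm1.comp y hr
  have hm2' : ContDiffAt ℝ 1 (fun y => m2 (rho x y)) y := hm2.comp y hr
  have hf := contDiffAt_flux hA hw
  have hp : ∀ j, ContDiffAt ℝ 1 (pd j w) y := fun j =>
    contDiffAt_pd (k := 1) (m := 2) j hw (by norm_num)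
  have hb := fun i => contDiffAt_bF (k := 1) (x := x) hA i
  have hal := contDiffAt_alF (k := 1) (x := x) hA
  have hw1 : ContDiffAt ℝ 1 w y := hw.of_le (by norm_num)
  unfold Jr Jf
  fun_prop

lemma Jr_zero {h m1 m2 : ℝ → ℝ} (hw : w =ᶠ[nhds y] fun _ => 0) (i : Fin n) :
    Jr A x h m1 m2 w τ i y = 0 := by
  have hp : ∀ j, pd j w y = 0 := fun j => by rw [pd_congr' j hw]; simp [pd]
  have hw0 : w y = 0 := hw.self_of_nhds
  unfold Jr Jf flux
  simp [hp, hw0]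

lemma cacc_pt (n : ℕ) {lam N D : ℝ} (hl : 0 < lam) (hN : 0 ≤ N) (hD : 0 < D) {Λ : ℝ} (hΛ : 0 < Λ) :
    ∃ K > 0, ∀ (A : Fin n → Fin n → EuclideanSpace ℝ (Fin n) → ℝ)
    (x y : EuclideanSpace ℝ (Fin n)) (u : EuclideanSpace ℝ (Fin n) → ℝ) (Z Z1 : ℝ → ℝ),
    CoefBd A lam N y → rho x y ≤ D ^ 2 → ContDiffAt ℝ 2 u y → |Lop A u y| ≤ Λ * |u y| →
    ContDiff ℝ 1 Z → (∀ t, HasDerivAt Z (Z1 t) t) →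
    Z (rho x y) ^ 2 * (∑ i, pd i u y * pd i u y) ≤ 2 / lam * ∑ i, pd i (J2 A x Z u i) y
      + K * (Z (rho x y) ^ 2 + Z1 (rho x y) ^ 2) * u y ^ 2 := by
  obtain ⟨C, hCp, hTb⟩ := T_bounds n hN hD.le
  refine ⟨2 / lam * (Λ + 8 * C * D ^ 2 / lam), by positivity, ?_⟩
  intro A x y u Z Z1 hc hρD hu hLu hZ hZ1
  obtain ⟨-, -, b3, -, -, -, -, -, b9, -⟩ := hTb A lam x y u hc hρD
  have hud : DifferentiableAt ℝ u y := hu.differentiableAt (by norm_num)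
  have hA' : ∀ i j, DifferentiableAt ℝ (A i j) y := fun i j =>
    (hc.cd i j).differentiableAt (by norm_num)
  have hZd : DifferentiableAt ℝ (fun y => Z (rho x y)) y :=
    (hZ1 _).differentiableAt.comp y diff_rho
  have hfd : ∀ i, DifferentiableAt ℝ (flux A u i) y := fun i =>
    (contDiffAt_flux hc.cd hu i).differentiableAt (by norm_num)
  have hdiv : ∑ i, pd i (J2 A x Z u i) y = Z (rho x y) ^ 2 * (∑ k, flux A u k y * pd k u y)
      + Z (rho x y) ^ 2 * u y * Lop A u y
      + 4 * Z (rho x y) * Z1 (rho x y) * u y * ∑ k, bF A x k y * pd k u y := by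
    rw [← div_flux hA' hu, ← sum_z_flux hc.sym, Finset.mul_sum, Finset.mul_sum, Finset.mul_sum,
      ← Finset.sum_add_distrib, ← Finset.sum_add_distrib]
    refine Finset.sum_congr rfl fun i _ => ?_
    unfold J2
    rw [pd_mul' i (hZd.fun_mul hZd) (hud.fun_mul (hfd i)), pd_mul' i hZd hZd,
      pd_mul' i hud (hfd i), pd_comp' i (hZ1 _) diff_rho, pd_rho]
    ring
  rw [hdiv]
  set p2 := ∑ i, pd i u y * pd i u y
  set X := ∑ k, flux A u k y * pd k u y
  set B := ∑ k, bF A x k y * pd k u y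
  have hp20 : 0 ≤ p2 := Finset.sum_nonneg fun i _ => mul_self_nonneg _
  set z := Z (rho x y)
  set z1 := Z1 (rho x y)
  have hB : B ^ 2 ≤ C * D ^ 2 * p2 := by
    calc B ^ 2 ≤ C * (rho x y * p2) := b9
      _ ≤ C * (D ^ 2 * p2) := by gcongr
      _ = _ := by ring
  have h1 : -(Λ * u y ^ 2) ≤ u y * Lop A u y := by
    have : |u y * Lop A u y| ≤ Λ * u y ^ 2 := by
      rw [abs_mul, ← sq_abs (u y)]
      calc |u y| * |Lop A u y| ≤ |u y| * (Λ * |u y|) := by gcongr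
        _ = _ := by ring
    exact (abs_le.1 this).1
  have h2 : -(lam / 2 * z ^ 2 * p2 + 8 * C * D ^ 2 / lam * z1 ^ 2 * u y ^ 2)
      ≤ 4 * z * z1 * u y * B := by
    set e := lam / (2 * C * D ^ 2) with he
    have he0 : 0 < e := by positivity
    have i1 : -(e * (z * B) ^ 2 + 4 / e * (z1 * u y) ^ 2) ≤ 4 * (z * B) * (z1 * u y) := by
      have : 0 ≤ e * ((z * B) + 2 / e * (z1 * u y)) ^ 2 := by positivity
      have h3 : e * ((z * B) + 2 / e * (z1 * u y)) ^ 2 = e * (z * B) ^ 2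
          + 4 * (z * B) * (z1 * u y) + 4 / e * (z1 * u y) ^ 2 := by field_simp; ring
      linarith
    have i2 : e * (z * B) ^ 2 ≤ lam / 2 * z ^ 2 * p2 := by
      calc e * (z * B) ^ 2 = e * z ^ 2 * B ^ 2 := by ring
        _ ≤ e * z ^ 2 * (C * D ^ 2 * p2) := by gcongr
        _ = _ := by rw [he]; field_simp
    have i3 : 4 / e * (z1 * u y) ^ 2 = 8 * C * D ^ 2 / lam * z1 ^ 2 * u y ^ 2 := by
      rw [he]; field_simp; ring
    linarith
  have h3 : z ^ 2 * (lam * p2) ≤ z ^ 2 * X := by gcongr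
  have h4 : z ^ 2 * (-(Λ * u y ^ 2)) ≤ z ^ 2 * (u y * Lop A u y) := by gcongr
  have h5 : lam / 2 * (z ^ 2 * p2) ≤ z ^ 2 * X + z ^ 2 * u y * Lop A u y + 4 * z * z1 * u y * B
      + (Λ * z ^ 2 + 8 * C * D ^ 2 / lam * z1 ^ 2) * u y ^ 2 := by linarith
  have h6 : 0 ≤ (Λ * z1 ^ 2 + 8 * C * D ^ 2 / lam * z ^ 2) * u y ^ 2 := by positivity
  have h7 : z ^ 2 * p2 = 2 / lam * (lam / 2 * (z ^ 2 * p2)) := by field_simp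
  rw [h7]
  calc _ ≤ 2 / lam * (z ^ 2 * X + z ^ 2 * u y * Lop A u y + 4 * z * z1 * u y * B
      + (Λ * z ^ 2 + 8 * C * D ^ 2 / lam * z1 ^ 2) * u y ^ 2
      + (Λ * z1 ^ 2 + 8 * C * D ^ 2 / lam * z ^ 2) * u y ^ 2) := by gcongr; linarith
    _ = _ := by ring
end cacc


lemma Q_bound (C C0 C1 K τ : ℝ) (hC : 0 < C) (hC0 : 0 < C0) (hC1 : 0 < C1) (hK : 0 < K)
    (hτ : 0 < τ) (k : ℕ) : ∃ T > 0, ∃ p : ℕ, ∀ r : ℝ, 0 < r → r ≤ 1 →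
    (C * Real.exp (τ * ((r ^ 2 / 16)⁻¹) ^ k) ^ 2 *
      (C0 * (((r ^ 2 / 16)⁻¹) ^ 2 + ((r ^ 2 / 16)⁻¹) ^ 4))) *
      (K * (1 + C1 * ((r ^ 2 / 16)⁻¹) ^ 2) + 1) ≤ Real.exp (T * (r⁻¹) ^ p) := by
  set B := C * C0 * 65792 * (K * (1 + 256 * C1) + 1) with hB
  have hB0 : 0 < B := by positivity
  refine ⟨2 * τ * 16 ^ k + B, by positivity, 2 * k + 12, fun r hr hr1 => ?_⟩
  set X := r⁻¹ with hX
  have hX1 : 1 ≤ X := (one_le_inv₀ hr).2 hr1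
  have hX0 : 0 < X := by linarith
  have e : (r ^ 2 / 16)⁻¹ = 16 * X ^ 2 := by rw [hX]; field_simp
  rw [e]
  have h1 : (16 * X ^ 2) ^ 2 + (16 * X ^ 2) ^ 4 ≤ 65792 * X ^ 8 := by
    have : X ^ 4 ≤ X ^ 8 := pow_le_pow_right₀ hX1 (by norm_num)
    nlinarith
  have h2 : K * (1 + C1 * (16 * X ^ 2) ^ 2) + 1 ≤ (K * (1 + 256 * C1) + 1) * X ^ 4 := by
    have : 1 ≤ X ^ 4 := one_le_pow₀ hX1
    have h3 : 0 ≤ (K + 1) * (X ^ 4 - 1) := mul_nonneg (by positivity) (by linarith)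
    linarith
  have h4 : Real.exp (τ * (16 * X ^ 2) ^ k) ^ 2 = Real.exp (2 * τ * 16 ^ k * X ^ (2 * k)) := by
    rw [← Real.exp_nat_mul, mul_pow, ← pow_mul]; congr 1; push_cast; ring
  have h5 : X ^ (2 * k) ≤ X ^ (2 * k + 12) := pow_le_pow_right₀ hX1 (by omega)
  have h6 : X ^ 12 ≤ X ^ (2 * k + 12) := pow_le_pow_right₀ hX1 (by omega)
  calc _ ≤ (C * Real.exp (2 * τ * 16 ^ k * X ^ (2 * k)) * (C0 * (65792 * X ^ 8))) *
        ((K * (1 + 256 * C1) + 1) * X ^ 4) := by rw [h4]; gcongr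
    _ = (B * X ^ 12) * Real.exp (2 * τ * 16 ^ k * X ^ (2 * k)) := by rw [hB]; ring
    _ ≤ Real.exp (B * X ^ 12) * Real.exp (2 * τ * 16 ^ k * X ^ (2 * k)) := by
        gcongr
        linarith [Real.add_one_le_exp (B * X ^ 12)]
    _ = Real.exp (B * X ^ 12 + 2 * τ * 16 ^ k * X ^ (2 * k)) := by rw [Real.exp_add]
    _ ≤ _ := by
        apply Real.exp_le_exp.2
        have : B * X ^ 12 ≤ B * X ^ (2 * k + 12) := by gcongr
        have h7 : 2 * τ * 16 ^ k * X ^ (2 * k) ≤ 2 * τ * 16 ^ k * X ^ (2 * k + 12) := by gcongr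
        linarith

lemma psi_gap {δ D R : ℝ} (hδ : 0 < δ) (hR : 8 * δ ≤ R) (hRD : R ≤ D) {k : ℕ} (hk : 1 ≤ k) :
    (δ ^ 2 / D ^ 4) * ((D ^ 2)⁻¹) ^ (k - 1) + (((R - 2 * δ) ^ 2)⁻¹) ^ k ≤ (((R - 3 * δ) ^ 2)⁻¹) ^ k := by
  obtain ⟨j, rfl⟩ : ∃ j, k = j + 1 := ⟨k - 1, by omega⟩
  have s1 : 0 < R - 3 * δ := by linarith
  have s2 : 0 < R - 2 * δ := by linarith
  have hD : 0 < D := by linarith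
  set P := ((R - 3 * δ) ^ 2)⁻¹ with hP
  set Q := ((R - 2 * δ) ^ 2)⁻¹ with hQ
  have hQ0 : 0 < Q := by positivity
  have hP0 : 0 < P := by positivity
  have hPQ : δ ^ 2 / D ^ 4 ≤ P - Q := by
    have : P - Q = (δ * (2 * R - 5 * δ)) / ((R - 3 * δ) ^ 2 * (R - 2 * δ) ^ 2) := by
      have s1n := s1.ne'
      have s2n := s2.ne'
      rw [hP, hQ, inv_sub_inv (pow_ne_zero 2 s1n) (pow_ne_zero 2 s2n)]; congr 1; ring
    rw [this]
    have h1 : (R - 3 * δ) ^ 2 * (R - 2 * δ) ^ 2 ≤ D ^ 4 := by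
      calc _ ≤ D ^ 2 * D ^ 2 := by gcongr <;> linarith
        _ = _ := by ring
    have h2 : δ ^ 2 ≤ δ * (2 * R - 5 * δ) := by nlinarith
    have h3 : 0 ≤ δ * (2 * R - 5 * δ) := le_trans (by positivity) h2
    gcongr
  have hQP : Q ≤ P := by
    have : 0 ≤ δ ^ 2 / D ^ 4 := by positivity
    linarith
  have hDQ : (D ^ 2)⁻¹ ≤ Q := by
    rw [hQ]; gcongr; linarith
  simp only [Nat.add_sub_cancel]
  calc _ ≤ (P - Q) * Q ^ j + Q ^ (j + 1) := by gcongr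
    _ = P * Q ^ j := by ring
    _ ≤ P * P ^ j := by gcongr
    _ = _ := by ring

lemma pd_sq_sum_le {n : ℕ} {u : EuclideanSpace ℝ (Fin n) → ℝ} {y : EuclideanSpace ℝ (Fin n)} {M : ℝ}
    (h : ‖fderiv ℝ u y‖ ≤ M) : ∑ i, pd i u y * pd i u y ≤ n * M ^ 2 := by
  have hM : 0 ≤ M := (norm_nonneg _).trans h
  have : ∀ i, pd i u y * pd i u y ≤ M ^ 2 := by
    intro i
    have h1 : |pd i u y| ≤ M := by
      unfold pd
      calc _ ≤ ‖fderiv ℝ u y‖ * ‖EuclideanSpace.single i (1 : ℝ)‖ :=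
            (fderiv ℝ u y).le_opNorm _
        _ ≤ M := by simpa using h
    rw [← sq, ← sq_abs]; gcongr
  calc _ ≤ ∑ _i : Fin n, M ^ 2 := Finset.sum_le_sum fun i _ => this i
    _ = _ := by simp

set_option maxHeartbeats 1000000 in
lemma interior_est (n : ℕ) {lam N D Λ M η δ : ℝ} (hl : 0 < lam) (hN : 0 ≤ N) (hD : 0 < D)
    (hΛ : 0 < Λ) (hM : 0 < M) (hη : 0 < η) (hδ : 0 < δ) :
    ∃ c1 > 0, ∃ T > 0, ∃ p : ℕ,
    ∀ (A : Fin n → Fin n → EuclideanSpace ℝ (Fin n) → ℝ)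
    (u : EuclideanSpace ℝ (Fin n) → ℝ) (x y0 : EuclideanSpace ℝ (Fin n)) (R r : ℝ),
    8 * δ ≤ R → R ≤ D → 0 < r → r ≤ δ → r ≤ 1 →
    (∀ y, ‖y - x‖ ≤ R - δ → CoefBd A lam N y ∧ ContDiffAt ℝ 2 u y ∧ |u y| ≤ M ∧
      ‖fderiv ℝ u y‖ ≤ M) →
    (∀ᵐ y ∂volume, ‖y - x‖ ≤ R - δ → |Lop A u y| ≤ Λ * |u y|) →
    ‖y0 - x‖ = R - 4 * δ → (∀ y ∈ ball y0 δ, η ≤ |u y|) →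
    c1 ≤ Real.exp (T * (r⁻¹) ^ p) * ∫ y in ball x r, u y ^ 2 := by
  obtain ⟨k, hk, hcar⟩ := carleman_pt n hl hN hD
  obtain ⟨C, hCp, τ0, hτ0, hcar⟩ := hcar Λ hΛ
  obtain ⟨K, hK, hcac⟩ := cacc_pt n hl hN hD hΛ
  obtain ⟨C0, hC0, hcut⟩ := cutoff
  obtain ⟨C1, hC1, hcut2⟩ := cutoff2
  set Vd := volume.real (ball (0 : EuclideanSpace ℝ (Fin n)) δ) with hVd
  set VD := volume.real (ball (0 : EuclideanSpace ℝ (Fin n)) D) with hVD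
  have hVd0 : 0 < Vd := ENNReal.toReal_pos (measure_ball_pos _ _ hδ).ne' measure_ball_lt_top.ne
  have hVD0 : 0 < VD := ENNReal.toReal_pos (measure_ball_pos _ _ hD).ne' measure_ball_lt_top.ne
  set κ := (D ^ 2)⁻¹ ^ 2 * η ^ 2 with hκ
  have hκ0 : 0 < κ := by positivity
  set γ := (δ ^ 2 / D ^ 4) * ((D ^ 2)⁻¹) ^ (k - 1) with hγ
  have hγ0 : 0 < γ := by positivity
  set Q2 := C * (C0 * (((δ ^ 2)⁻¹) ^ 2 + ((δ ^ 2)⁻¹) ^ 4)) * (M ^ 2 + n * M ^ 2) with hQ2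
  have hQ20 : 0 < Q2 := by positivity
  set τ := τ0 + 2 * Q2 * VD / (κ * γ * Vd) with hτ
  have hτ00 : τ0 ≤ τ := by
    have : 0 ≤ 2 * Q2 * VD / (κ * γ * Vd) := by positivity
    linarith
  have hτp : 0 < τ := by linarith
  have hτ2 : Q2 * VD ≤ κ * (τ * γ) * Vd / 2 := by
    have h1 : κ * (2 * Q2 * VD / (κ * γ * Vd) * γ) * Vd / 2 = Q2 * VD := by field_simp
    rw [← h1]
    gcongr
    linarith
  obtain ⟨T, hT, p, hQb⟩ := Q_bound C C0 C1 K τ hCp hC0 hC1 hK hτp k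
  refine ⟨κ * Vd / 2, by positivity, T, hT, p, ?_⟩
  intro A u x y0 R r hR hRD hr hrδ hr1 hyp hae hy0 hu0
  set a := r ^ 2 / 16 with ha
  have ha0 : 0 < a := by positivity
  set b := (R - δ) ^ 2 with hb
  set b' := (R - 2 * δ) ^ 2 with hb'
  have hab : 4 * a < b' := by
    have : r ^ 2 ≤ δ ^ 2 := by gcongr
    have h2 : (6 * δ) ^ 2 ≤ b' := by rw [hb']; gcongr; linarith
    nlinarith
  have hbb : δ ^ 2 ≤ b - b' := by rw [hb, hb']; nlinarith
  obtain ⟨F, F1, F2, hFc, hF1, hF2, hFa, hFb, hFm, hF12, hFin, hFout⟩ :=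
    hcut a b b' ha0 (by linarith) (by nlinarith)
  obtain ⟨Z, Z1, hZc, hZ1, hZin, hZout, hZle, hZ1le⟩ := hcut2 a ha0
  set w := wF x (Phi k τ F) u with hw
  set Jc := fun i => Jr A x (hC k) (m1C k) (m2C k) w τ i with hJc
  set Jz := fun i => J2 A x Z u i with hJz
  have hrc : Continuous (rho x) := (contDiff_rho (k := 0)).continuous
  have hnorm : ∀ y c, 0 ≤ c → (rho x y ≤ c ^ 2 ↔ ‖y - x‖ ≤ c) := fun y c hc => by
    rw [rho_eq, pow_le_pow_iff_left₀ (norm_nonneg _) hc (by norm_num)]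
  have hRδ : 0 ≤ R - δ := by linarith
  have cpt : ∀ s : Set (EuclideanSpace ℝ (Fin n)), IsClosed s → (∀ y ∈ s, rho x y ≤ b) →
      IsCompact s := fun s hs h =>
    (isCompact_closedBall x (R - δ)).of_isClosed_subset hs fun y hy => by
      rw [mem_closedBall, dist_eq_norm]; exact (hnorm y _ hRδ).1 (h y hy)
  set S : Set (EuclideanSpace ℝ (Fin n)) := {y | a ≤ rho x y ∧ rho x y ≤ b} with hS
  have hSc : IsClosed S := (isClosed_le continuous_const hrc).inter (isClosed_le hrc continuous_const)
  have hSk : IsCompact S := cpt S hSc fun y hy => hy.2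
  set S2 : Set (EuclideanSpace ℝ (Fin n)) := {y | rho x y ≤ 4 * a} with hS2
  have hS2c : IsClosed S2 := isClosed_le hrc continuous_const
  have hb'b : b' ≤ b := by
    have : 0 < δ ^ 2 := by positivity
    linarith
  have hS2k : IsCompact S2 := cpt S2 hS2c fun y hy => by
    have : rho x y ≤ 4 * a := hy
    linarith
  have hJ0 : ∀ i, ∀ y, y ∉ S → Jc i y = 0 := by
    intro i y hy
    apply Jr_zero
    filter_upwards [hSc.isOpen_compl.mem_nhds hy] with z hz
    have hz' : rho x z < a ∨ b < rho x z := by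
      by_contra! h; exact hz h
    have hF0 : F (rho x z) = 0 := by
      rcases hz' with h | h
      · exact hFa _ h.le
      · exact hFb _ h.le
    simp [hw, wF, Phi, hF0]
  have hJz0 : ∀ i, ∀ y, y ∉ S2 → Jz i y = 0 := by
    intro i y hy
    have : 4 * a < rho x y := not_le.1 hy
    simp [hJz, J2, hZout _ this.le]
  have hJcd : ∀ i, ∀ y ∈ S, ContDiffAt ℝ 1 (Jc i) y := by
    intro i y hy
    have hρ : rho x y ≠ 0 := (lt_of_lt_of_le ha0 hy.1).ne'
    obtain ⟨q1, q2, -, -⟩ := hyp y ((hnorm y _ hRδ).1 hy.2)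
    have cinv : ContDiffAt ℝ 1 (fun t : ℝ => t⁻¹) (rho x y) := contDiffAt_inv ℝ hρ
    refine contDiffAt_Jr q1.cd
      (contDiffAt_wF (m := 2) (contDiffAt_Phi (m := 2) k τ hρ hFc.contDiffAt) q2) ?_ ?_ ?_ i
    · unfold hC; exact contDiffAt_const.mul (cinv.pow _)
    · unfold m1C; exact contDiffAt_const.mul (cinv.pow _)
    · unfold m2C; exact contDiffAt_const.mul (cinv.pow _)
  have hJzcd : ∀ i, ∀ y ∈ S2, ContDiffAt ℝ 1 (Jz i) y := by
    intro i y hy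
    have hy' : rho x y ≤ 4 * a := hy
    obtain ⟨q1, q2, -, -⟩ := hyp y ((hnorm y _ hRδ).1 (by linarith))
    exact contDiffAt_J2 q1.cd q2 hZc i
  obtain ⟨i1, z1⟩ := int_div_zero hSk hJcd hJ0
  obtain ⟨i2, z2⟩ := int_div_zero hS2k hJzcd hJz0
  set dJ := fun y => ∑ i, pd i (Jc i) y with hdJ
  set dZ := fun y => ∑ i, pd i (Jz i) y with hdZ
  set E := Real.exp (τ * (a⁻¹) ^ k) with hE
  set Q1 := C * E ^ 2 * (C0 * ((a⁻¹) ^ 2 + (a⁻¹) ^ 4)) with hQ1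
  have hQ10 : 0 < Q1 := by positivity
  set Q3 := K * (1 + C1 * (a⁻¹) ^ 2) + 1 with hQ3
  have hQ30 : 0 < Q3 := by positivity
  set e1 := Real.exp (τ * (((R - 3 * δ) ^ 2)⁻¹) ^ k) with he1
  set e2 := Real.exp (τ * (b'⁻¹) ^ k) with he2
  set iu := (ball x r).indicator (fun y => u y ^ 2) with hiu
  have hiu0 : ∀ y, 0 ≤ iu y := fun y => indicator_nonneg (fun _ _ => sq_nonneg _) y
  set i0 := (ball y0 δ).indicator (fun _ => κ * e1 ^ 2) with hi0
  set iR := (ball x R).indicator (fun _ => Q2 * e2 ^ 2) with hiR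
  have hiR0 : ∀ y, 0 ≤ iR y := fun y => indicator_nonneg (fun _ _ => by positivity) y
  have hG : ∀ᵐ y ∂volume, 0 ≤ 2 / lam * dZ y + Q3 * iu y ∧ (rho x y ≤ 2 * a →
      u y ^ 2 + ∑ i, pd i u y * pd i u y ≤ 2 / lam * dZ y + Q3 * iu y) := by
    filter_upwards [hae] with y hy
    rcases le_or_gt (rho x y) (4 * a) with h | h
    · have hyb : rho x y ≤ b := by linarith
      have hyn := (hnorm y _ hRδ).1 hyb
      obtain ⟨q1, q2, -, -⟩ := hyp y hyn
      have hyr : y ∈ ball x r := by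
        have : ‖y - x‖ ≤ r / 2 := (hnorm y _ (by linarith)).1 (by rw [ha] at h; linarith)
        rw [mem_ball, dist_eq_norm]; linarith
      have hρD : rho x y ≤ D ^ 2 := (hnorm y _ hD.le).2 (by linarith)
      have hc := hcac A x y u Z Z1 q1 hρD q2 (hy hyn) hZc hZ1
      have hiuy : iu y = u y ^ 2 := indicator_of_mem hyr _
      have hp20 : 0 ≤ ∑ i, pd i u y * pd i u y := Finset.sum_nonneg fun i _ => mul_self_nonneg _
      have hmain : Z (rho x y) ^ 2 * (u y ^ 2 + ∑ i, pd i u y * pd i u y)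
          ≤ 2 / lam * dZ y + Q3 * iu y := by
        rw [hiuy, hQ3]
        have h1 : K * (Z (rho x y) ^ 2 + Z1 (rho x y) ^ 2) * u y ^ 2 ≤
            K * (1 + C1 * (a⁻¹) ^ 2) * u y ^ 2 := by
          gcongr
          · exact hZle _
          · exact hZ1le _
        have h2 : Z (rho x y) ^ 2 * u y ^ 2 ≤ 1 * u y ^ 2 := by
          gcongr; exact hZle _
        linarith
      refine ⟨le_trans (by positivity) hmain, fun h' => ?_⟩
      rw [hZin _ h'] at hmain
      linarith
    · have : dZ y = 0 := pd_div_off hS2c hJz0 (not_le.2 h)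
      rw [this]
      refine ⟨by have := hiu0 y; positivity, fun h' => by linarith⟩
  have hmain : ∀ᵐ y ∂volume, i0 y + dJ y ≤ Q1 * (2 / lam * dZ y + Q3 * iu y) + iR y := by
    filter_upwards [hae, hG] with y hy hGy
    obtain ⟨hG0, hG1⟩ := hGy
    have hball : y ∈ ball y0 δ → ‖y - x‖ ≤ R - 3 * δ ∧ R - 5 * δ ≤ ‖y - x‖ := by
      intro h
      rw [mem_ball, dist_eq_norm] at h
      have e : y - x = (y - y0) + (y0 - x) := by abel
      have e' : y0 - x = (y - x) - (y - y0) := by abel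
      have n1 := norm_add_le (y - y0) (y0 - x)
      have n2 := norm_sub_le (y - x) (y - y0)
      rw [← e] at n1; rw [← e'] at n2
      constructor <;> linarith
    have hball2 : y ∈ ball y0 δ → 2 * a ≤ rho x y ∧ rho x y ≤ (R - 3 * δ) ^ 2 := by
      intro h
      obtain ⟨n1, n2⟩ := hball h
      refine ⟨?_, (hnorm y _ (by linarith)).2 n1⟩
      rw [rho_eq]
      have h2 : r ^ 2 ≤ ‖y - x‖ ^ 2 := by gcongr; linarith
      have : 0 < r ^ 2 := by positivity
      linarith
    by_cases hyS : y ∈ S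
    · have hρ0 : 0 < rho x y := lt_of_lt_of_le ha0 hyS.1
      have hyn := (hnorm y _ hRδ).1 hyS.2
      obtain ⟨q1, q2, q3, q4⟩ := hyp y hyn
      have hρD : rho x y ≤ D ^ 2 := (hnorm y _ hD.le).2 (by linarith)
      have hc := hcar τ hτ00 A x y u F F1 F2 q1 hρ0 hρD q2 (hy hyn) hFc hF1 hF2
      have hp20 : 0 ≤ ∑ i, pd i u y * pd i u y := Finset.sum_nonneg fun i _ => mul_self_nonneg _
      have hL : i0 y ≤ ((rho x y)⁻¹) ^ 2 * (w y) ^ 2 := by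
        by_cases hyb : y ∈ ball y0 δ
        · obtain ⟨n1, n2⟩ := hball2 hyb
          have hFy : F (rho x y) = 1 := hFm _ n1 (n2.trans (by
            rw [hb']; gcongr <;> linarith))
          have : i0 y = κ * e1 ^ 2 := indicator_of_mem hyb _
          rw [this]
          have hwy : w y = Real.exp (τ * ((rho x y)⁻¹) ^ k) * u y := by
            simp [hw, wF, Phi, hFy]
          rw [hwy, mul_pow, ← sq_abs (u y), hκ]
          have hee : e1 ≤ Real.exp (τ * ((rho x y)⁻¹) ^ k) := by
            rw [he1]; gcongr
          have := hu0 y hyb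
          calc (D ^ 2)⁻¹ ^ 2 * η ^ 2 * e1 ^ 2
              ≤ ((rho x y)⁻¹) ^ 2 * |u y| ^ 2 * Real.exp (τ * ((rho x y)⁻¹) ^ k) ^ 2 := by gcongr
            _ = _ := by ring
        · have : i0 y = 0 := indicator_of_notMem hyb _
          rw [this]; positivity
      refine le_trans (add_le_add_left hL _) (hc.trans ?_)
      have hiRy := hiR0 y
      rcases le_or_gt (rho x y) (2 * a) with h | h
      · have h1 := hG1 h
        have h2 : Real.exp (τ * ((rho x y)⁻¹) ^ k) ≤ E := by
          have := hyS.1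
          rw [hE]; gcongr
        calc _ ≤ C * E ^ 2 * (C0 * ((a⁻¹) ^ 2 + (a⁻¹) ^ 4)) * (2 / lam * dZ y + Q3 * iu y) := by
              gcongr
              exact hFin _ h
          _ ≤ _ := by rw [hQ1]; linarith
      · have hQG : 0 ≤ Q1 * (2 / lam * dZ y + Q3 * iu y) := by positivity
        rcases lt_or_ge (rho x y) b' with h' | h'
        · obtain ⟨f1, f2⟩ := hF12 _ h h'
          rw [f1, f2]
          simp only [ne_eq, OfNat.ofNat_ne_zero, not_false_eq_true, zero_pow, add_zero, mul_zero,
            zero_mul]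
          positivity
        · have hyR : y ∈ ball x R := by
            rw [mem_ball, dist_eq_norm]; linarith
          have : iR y = Q2 * e2 ^ 2 := indicator_of_mem hyR _
          rw [this]
          have hb'0 : 0 < b' := by linarith
          have h2 : Real.exp (τ * ((rho x y)⁻¹) ^ k) ≤ e2 := by
            rw [he2]; gcongr
          have h3 : F1 (rho x y) ^ 2 + F2 (rho x y) ^ 2 ≤
              C0 * (((δ ^ 2)⁻¹) ^ 2 + ((δ ^ 2)⁻¹) ^ 4) := by
            refine (hFout _ h').trans ?_
            gcongr
          have h4 : u y ^ 2 ≤ M ^ 2 := by rw [← sq_abs]; gcongr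
          have h5 := pd_sq_sum_le q4
          calc _ ≤ C * e2 ^ 2 * (C0 * (((δ ^ 2)⁻¹) ^ 2 + ((δ ^ 2)⁻¹) ^ 4)) * (M ^ 2 + n * M ^ 2) := by
                gcongr
            _ = Q2 * e2 ^ 2 := by rw [hQ2]; ring
            _ ≤ _ := by linarith
    · have hd : dJ y = 0 := pd_div_off hSc hJ0 hyS
      have hyb : y ∉ ball y0 δ := fun h => hyS (by
        obtain ⟨n1, n2⟩ := hball2 h
        refine ⟨by linarith, n2.trans ?_⟩
        rw [hb]; gcongr <;> linarith)
      have : i0 y = 0 := indicator_of_notMem hyb _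
      rw [this, hd, add_zero]
      have := hiR0 y
      positivity
  -- integrate
  have ii0 : Integrable i0 := (integrable_indicator_iff measurableSet_ball).2
    (integrableOn_const measure_ball_lt_top.ne)
  have iiR : Integrable iR := (integrable_indicator_iff measurableSet_ball).2
    (integrableOn_const measure_ball_lt_top.ne)
  have iiu : Integrable iu := by
    refine (integrable_indicator_iff measurableSet_ball).2 ?_
    have : ContinuousOn (fun y => u y ^ 2) (closedBall x r) := by
      intro y hy
      rw [mem_closedBall, dist_eq_norm] at hy
      exact ((hyp y (by linarith)).2.1.continuousAt.pow 2).continuousWithinAt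
    exact (this.integrableOn_compact (isCompact_closedBall x r)).mono_set ball_subset_closedBall
  have hInt0 := integral_mono_ae (ii0.add i1)
    (((i2.const_mul (2 / lam)).add (iiu.const_mul Q3)).const_mul Q1 |>.add iiR) hmain
  have s0 : ∫ y, i0 y = Vd * (κ * e1 ^ 2) := by
    rw [hi0, integral_indicator measurableSet_ball, setIntegral_const, smul_eq_mul, hVd,
      Measure.real, Measure.real, Measure.addHaar_ball_center]
  have sR : ∫ y, iR y ≤ VD * (Q2 * e2 ^ 2) := by
    rw [hiR, integral_indicator measurableSet_ball, setIntegral_const, smul_eq_mul, hVD,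
      Measure.real, Measure.real, Measure.addHaar_ball_center]
    gcongr
    exact measure_ball_lt_top.ne
  have su : ∫ y, iu y = ∫ y in ball x r, u y ^ 2 := integral_indicator measurableSet_ball
  have hL : ∫ y, (i0 + dJ) y = Vd * (κ * e1 ^ 2) := by
    have := integral_add ii0 i1
    simp only [Pi.add_apply]
    rw [this, s0, z1, add_zero]
  have hRr : ∫ y, (Q1 * (2 / lam * dZ y + Q3 * iu y) + iR y)
      = Q1 * (Q3 * ∫ y in ball x r, u y ^ 2) + ∫ y, iR y := by
    have i3 : Integrable (fun y => Q1 * (2 / lam * dZ y + Q3 * iu y)) :=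
      ((i2.const_mul (2 / lam)).add (iiu.const_mul Q3)).const_mul Q1
    rw [integral_add i3 iiR]
    rw [integral_const_mul, integral_add (i2.const_mul (2 / lam)) (iiu.const_mul Q3),
      integral_const_mul, integral_const_mul, z2, su]
    ring
  have hfin : Vd * (κ * e1 ^ 2) ≤ Q1 * (Q3 * ∫ y in ball x r, u y ^ 2) + VD * (Q2 * e2 ^ 2) := by
    rw [← hL]
    refine le_trans hInt0 ?_
    refine le_trans (le_of_eq hRr) ?_
    linarith
  have hgap := psi_gap hδ hR hRD hk
  have hee : e2 * (τ * γ) ≤ e2 * Real.exp (τ * γ) := by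
    gcongr
    linarith [Real.add_one_le_exp (τ * γ)]
  have hee2 : e2 * Real.exp (τ * γ) ≤ e1 := by
    rw [he1, he2, ← Real.exp_add]
    apply Real.exp_le_exp.2
    have : τ * (γ + (b'⁻¹) ^ k) ≤ τ * (((R - 3 * δ) ^ 2)⁻¹) ^ k := by gcongr
    linarith
  have h1e2 : 1 ≤ e2 := Real.one_le_exp (by positivity)
  have h1x : 1 ≤ Real.exp (τ * γ) := Real.one_le_exp (by positivity)
  have hee3 : e2 ^ 2 * (τ * γ) ≤ e1 ^ 2 := by
    calc e2 ^ 2 * (τ * γ) = e2 * (e2 * (τ * γ)) := by ring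
      _ ≤ e1 * e1 := by
        gcongr
        · calc e2 = e2 * 1 := by ring
            _ ≤ e2 * Real.exp (τ * γ) := by gcongr
            _ ≤ e1 := hee2
        · exact hee.trans hee2
      _ = _ := by ring
  have h1e1 : 1 ≤ e1 ^ 2 := one_le_pow₀ (Real.one_le_exp (by
    have : 0 < R - 3 * δ := by linarith
    positivity))
  have habs : VD * (Q2 * e2 ^ 2) ≤ κ * Vd / 2 * e1 ^ 2 := by
    calc VD * (Q2 * e2 ^ 2) = (Q2 * VD) * e2 ^ 2 := by ring
      _ ≤ (κ * (τ * γ) * Vd / 2) * e2 ^ 2 := by gcongr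
      _ = κ * Vd / 2 * (e2 ^ 2 * (τ * γ)) := by ring
      _ ≤ _ := by gcongr
  have hI0 : 0 ≤ ∫ y in ball x r, u y ^ 2 := integral_nonneg fun y => sq_nonneg _
  calc κ * Vd / 2 = κ * Vd / 2 * 1 := by ring
    _ ≤ κ * Vd / 2 * e1 ^ 2 := by gcongr
    _ ≤ (Q1 * Q3) * ∫ y in ball x r, u y ^ 2 := by linarith
    _ ≤ _ := by
      gcongr
      exact hQb r hr hr1


lemma final_exp {c1 T : ℝ} (hc1 : 0 < c1) (hT : 0 < T) (p : ℕ) : ∃ c0 > 0, ∀ c, c0 ≤ c →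
    ∀ r : ℝ, 0 < r → ∀ I : ℝ, c1 ≤ Real.exp (T * (r⁻¹) ^ p) * I →
    Real.exp (-(c * Real.exp (c / r))) ≤ I ^ (1 / 2 : ℝ) := by
  refine ⟨1 + |Real.log c1| + T * p.factorial, by positivity, ?_⟩
  intro c hc r hr I hI
  set X := r⁻¹ with hX
  have hX0 : 0 < X := inv_pos.2 hr
  have hTp : 0 ≤ T * p.factorial := by positivity
  have hL := abs_nonneg (Real.log c1)
  have hc0 : 1 ≤ c := by linarith
  rw [← Real.sqrt_eq_rpow, div_eq_mul_inv, ← hX]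
  apply Real.le_sqrt_of_sq_le
  have h1 : X ^ p ≤ p.factorial * Real.exp X := by
    have := Real.pow_div_factorial_le_exp X hX0.le p
    rwa [div_le_iff₀' (by positivity)] at this
  have h2 : Real.exp X ≤ Real.exp (c * X) := Real.exp_le_exp.2 (by nlinarith)
  have h3 : 1 ≤ Real.exp (c * X) := Real.one_le_exp (by positivity)
  have h4 : -Real.log c1 + T * X ^ p ≤ 2 * (c * Real.exp (c * X)) := by
    have i1 : T * X ^ p ≤ T * p.factorial * Real.exp (c * X) := by
      calc T * X ^ p ≤ T * (p.factorial * Real.exp X) := by gcongr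
        _ ≤ T * (p.factorial * Real.exp (c * X)) := by gcongr
        _ = _ := by ring
    have i2 : -Real.log c1 ≤ |Real.log c1| * Real.exp (c * X) := by
      calc -Real.log c1 ≤ |Real.log c1| * 1 := by rw [mul_one]; exact neg_le_abs _
        _ ≤ _ := by gcongr
    have i3 : (1 + |Real.log c1| + T * p.factorial) * Real.exp (c * X) ≤ c * Real.exp (c * X) := by
      gcongr
    have i4 : 0 ≤ c * Real.exp (c * X) := by positivity
    linarith
  have h5 : c1 * Real.exp (-(T * X ^ p)) ≤ I := by
    rw [Real.exp_neg, ← div_eq_mul_inv, div_le_iff₀' (Real.exp_pos _)]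
    exact hI
  refine le_trans ?_ h5
  rw [← Real.exp_nat_mul]
  calc _ ≤ Real.exp (Real.log c1 + -(T * X ^ p)) := by
        apply Real.exp_le_exp.2; push_cast; linarith
    _ = _ := by rw [Real.exp_add, Real.exp_log hc1]

section geom
variable {n : ℕ} {Ω : Set (EuclideanSpace ℝ (Fin n))}

lemma mem_of_infDist_pos (hΩo : IsOpen Ω) {x : EuclideanSpace ℝ (Fin n)}
    (hx : x ∈ closure Ω) (h : 0 < infDist x (frontier Ω)) : x ∈ Ω := by
  by_contra hn
  have : x ∈ frontier Ω := by rw [hΩo.frontier_eq]; exact ⟨hx, hn⟩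
  rw [infDist_zero_of_mem this] at h
  exact lt_irrefl _ h

lemma ball_sub_dom (hΩo : IsOpen Ω) {x : EuclideanSpace ℝ (Fin n)}
    (hx : x ∈ Ω) {R : ℝ} (hR : 0 < R) (h : R ≤ infDist x (frontier Ω)) : ball x R ⊆ Ω := by
  refine IsPreconnected.subset_of_closure_inter_subset (convex_ball x R).isPreconnected hΩo
    ⟨x, mem_ball_self hR, hx⟩ ?_
  rintro y ⟨hy, hyb⟩
  by_contra hn
  have hyf : y ∈ frontier Ω := by rw [hΩo.frontier_eq]; exact ⟨hy, hn⟩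
  have := infDist_le_dist_of_mem hyf (x := x)
  rw [mem_ball, dist_comm] at hyb
  linarith

lemma inner_ball (hΩo : IsOpen Ω) (hfc : IsCompact (frontier Ω)) (hfn : (frontier Ω).Nonempty)
    (hcone : UniformIntConeProperty Ω) :
    ∃ σ > 0, ∃ R0 > 0, ∀ x ∈ closure Ω, ∀ r, 0 < r → r ≤ R0 →
      ∃ z, ball z (σ * r) ⊆ ball x r ∩ Ω := by
  obtain ⟨R0, hR0, θ, hθ0, hθ1, hc⟩ := hcone
  have hcos : Real.cos θ < 1 := by
    have := Real.cos_lt_cos_of_nonneg_of_le_pi (x := 0) (y := θ) le_rfl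
      (by linarith [Real.pi_pos]) hθ0
    simpa using this
  have hcos0 : 0 < Real.cos θ := Real.cos_pos_of_mem_Ioo ⟨by linarith, hθ1⟩
  set σ := (1 - Real.cos θ) / 2 with hσ
  have hσ0 : 0 < σ := by rw [hσ]; linarith
  have hσ1 : σ < 1 / 2 := by rw [hσ]; linarith
  have hσ2 : (1 + σ) * Real.cos θ ≤ 1 - σ := by rw [hσ]; nlinarith
  refine ⟨σ / 4, by positivity, R0, hR0, fun x hx r hr hrR => ?_⟩
  rcases lt_or_ge (infDist x (frontier Ω)) (r / 2) with h | h
  · obtain ⟨xt, hxt, hd⟩ := hfc.exists_infDist_eq_dist hfn x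
    obtain ⟨ξ, hξ, hsub⟩ := hc xt hxt
    set s := r / 4 with hs
    refine ⟨xt + s • ξ, fun y hy => ?_⟩
    set v := y - (xt + s • ξ) with hv
    have hvn : ‖v‖ < σ * s := by
      rw [mem_ball, dist_eq_norm] at hy
      have : σ * s = σ / 4 * r := by rw [hs]; ring
      rw [this]; exact hy
    have hyx : y - xt = s • ξ + v := by rw [hv]; abel
    have hsn : ‖s • ξ‖ = s := by rw [norm_smul, hξ, mul_one]; exact abs_of_pos (by positivity)
    have hn : ‖y - xt‖ < (1 + σ) * s := by
      rw [hyx]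
      have := norm_add_le (s • ξ) v
      linarith
    have hs0 : 0 < s := by positivity
    constructor
    · rw [mem_ball]
      have h1 : dist y xt < (1 + σ) * s := by rw [dist_eq_norm]; exact hn
      have h2 := dist_triangle y xt x
      rw [dist_comm xt x, ← hd] at h2
      nlinarith
    · apply hsub
      refine ⟨by nlinarith, ?_⟩
      have h1 : -‖v‖ ≤ ⟪v, ξ⟫ := by
        have := abs_real_inner_le_norm v ξ
        rw [hξ, mul_one] at this
        exact (abs_le.1 this).1
      have h2 : ⟪y - xt, ξ⟫ = s + ⟪v, ξ⟫ := by
        rw [hyx, inner_add_left, real_inner_smul_left, real_inner_self_eq_norm_sq, hξ]; ring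
      rw [h2]
      calc ‖y - xt‖ * Real.cos θ ≤ ((1 + σ) * s) * Real.cos θ := by gcongr
        _ = ((1 + σ) * Real.cos θ) * s := by ring
        _ ≤ (1 - σ) * s := by gcongr
        _ < _ := by linarith
  · have hxΩ := mem_of_infDist_pos hΩo hx (by linarith)
    refine ⟨x, fun y hy => ?_⟩
    rw [mem_ball] at hy
    have : σ / 4 * r < r / 2 := by nlinarith
    exact ⟨by rw [mem_ball]; linarith, ball_sub_dom hΩo hxΩ (by linarith) h (by rw [mem_ball]; linarith)⟩

lemma near_est (hfc : IsCompact (closure Ω)) {η σ : ℝ} (hη : 0 < η) (hσ : 0 < σ) :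
    ∃ c1 > 0, ∃ p : ℕ, ∀ (u : EuclideanSpace ℝ (Fin n) → ℝ) (x z : EuclideanSpace ℝ (Fin n)) (r : ℝ),
    0 < r → ContinuousOn u (closure Ω) → MeasurableSet Ω →
    ball z (σ * r) ⊆ ball x r ∩ Ω → (∀ y ∈ ball x r ∩ Ω, η ≤ |u y|) →
    c1 ≤ Real.exp (1 * (r⁻¹) ^ p) * ∫ y in ball x r ∩ Ω, u y ^ 2 := by
  set V := volume.real (ball (0 : EuclideanSpace ℝ (Fin n)) 1) with hV
  have hV0 : 0 < V := ENNReal.toReal_pos (measure_ball_pos _ _ one_pos).ne' measure_ball_lt_top.ne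
  refine ⟨η ^ 2 * (σ ^ n * V), by positivity, n, ?_⟩
  intro u x z r hr hu hm hsub hlow
  have hInt0 : IntegrableOn (fun y => u y ^ 2) (ball x r ∩ Ω) :=
    ((hu.pow 2).integrableOn_compact hfc).mono_set (inter_subset_right.trans subset_closure)
  have h1 : ∫ y in ball z (σ * r), u y ^ 2 ≤ ∫ y in ball x r ∩ Ω, u y ^ 2 :=
    setIntegral_mono_set hInt0 (Filter.Eventually.of_forall fun y => sq_nonneg _)
      (Filter.Eventually.of_forall hsub)
  have h2 : ∫ _y in ball z (σ * r), η ^ 2 ≤ ∫ y in ball z (σ * r), u y ^ 2 := by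
    refine setIntegral_mono_on (integrableOn_const measure_ball_lt_top.ne) (hInt0.mono_set hsub)
      measurableSet_ball fun y hy => ?_
    have := hlow y (hsub hy)
    rw [← sq_abs (u y)]; gcongr
  have h3 : ∫ _y in ball z (σ * r), η ^ 2 = (σ * r) ^ n * V * η ^ 2 := by
    rw [setIntegral_const, smul_eq_mul, Measure.real, Measure.addHaar_ball_of_pos _ _ (by positivity),
      ENNReal.toReal_mul, ENNReal.toReal_ofReal (by positivity), hV, Measure.real]
    simp
  have h4 : (r⁻¹) ^ n ≤ Real.exp (1 * (r⁻¹) ^ n) := by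
    rw [one_mul]; linarith [Real.add_one_le_exp ((r⁻¹) ^ n)]
  calc η ^ 2 * (σ ^ n * V) = (r⁻¹) ^ n * ((σ * r) ^ n * V * η ^ 2) := by
        rw [mul_pow, inv_pow]; field_simp
    _ ≤ Real.exp (1 * (r⁻¹) ^ n) * ∫ y in ball x r ∩ Ω, u y ^ 2 := by
        gcongr
        linarith

lemma coef_bd (hΩo : IsOpen Ω) (hΩc : IsCompact (closure Ω))
    {A : Fin n → Fin n → EuclideanSpace ℝ (Fin n) → ℝ} (hA : EllipticSym Ω A) {δ : ℝ} (hδ : 0 < δ) :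
    ∃ lam > 0, ∃ N, 0 ≤ N ∧ ∀ y ∈ Ω, δ ≤ infDist y (frontier Ω) → CoefBd A lam N y := by
  obtain ⟨hs, hcd, lam, hl, he⟩ := hA
  have hcdA : ∀ y ∈ Ω, ∀ i j, ContDiffAt ℝ 1 (A i j) y := fun y hy i j =>
    (hcd i j).contDiffAt (Filter.mem_of_superset (hΩo.mem_nhds hy) subset_closure)
  set K := closure Ω ∩ {y | δ ≤ infDist y (frontier Ω)} with hK
  have hKc : IsCompact K := hΩc.inter_right (isClosed_le continuous_const (continuous_infDist_pt _))
  have hKΩ : K ⊆ Ω := fun y hy => mem_of_infDist_pos hΩo hy.1 (lt_of_lt_of_le hδ hy.2)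
  set g : EuclideanSpace ℝ (Fin n) → ℝ := fun y => (∑ q : Fin n × Fin n, |A q.1 q.2 y|)
    + ∑ q : Fin n × Fin n × Fin n, |pd q.1 (A q.2.1 q.2.2) y| with hg
  have hgc : ContinuousOn g K := by
    intro y hy
    have h1 := hcdA y (hKΩ hy)
    have h2 : ∀ k i j, ContinuousAt (pd k (A i j)) y := fun k i j =>
      (contDiffAt_pd (k := 0) (m := 1) k (h1 i j) (by norm_num)).continuousAt
    have h3 : ∀ i j, ContinuousAt (A i j) y := fun i j => (h1 i j).continuousAt
    apply ContinuousAt.continuousWithinAt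
    rw [hg]
    exact (tendsto_finsetSum _ fun q _ => (h3 _ _).abs).add
      (tendsto_finsetSum _ fun q _ => (h2 _ _ _).abs)
  obtain ⟨N, hN⟩ := hKc.exists_bound_of_continuousOn hgc
  refine ⟨lam, hl, max N 0, le_max_right _ _, fun y hy hyd => ?_⟩
  have hyK : y ∈ K := ⟨subset_closure hy, hyd⟩
  have hgN : g y ≤ max N 0 := (le_abs_self _).trans ((hN y hyK).trans (le_max_left _ _))
  have p1 : 0 ≤ ∑ q : Fin n × Fin n, |A q.1 q.2 y| := Finset.sum_nonneg fun _ _ => abs_nonneg _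
  have p2 : 0 ≤ ∑ q : Fin n × Fin n × Fin n, |pd q.1 (A q.2.1 q.2.2) y| :=
    Finset.sum_nonneg fun _ _ => abs_nonneg _
  refine ⟨hcdA y hy, fun i j => hs i j y (subset_closure hy), fun i j => ?_, fun k i j => ?_, he y hy⟩
  · have := Finset.single_le_sum (f := fun q : Fin n × Fin n => |A q.1 q.2 y|)
      (fun _ _ => abs_nonneg _) (Finset.mem_univ (i, j))
    simp only [hg] at hgN
    simp only at this
    linarith
  · have := Finset.single_le_sum (f := fun q : Fin n × Fin n × Fin n => |pd q.1 (A q.2.1 q.2.2) y|)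
      (fun _ _ => abs_nonneg _) (Finset.mem_univ (k, i, j))
    simp only [hg] at hgN
    simp only at this
    linarith
end geom

theorem stmt_12 {n : ℕ} (hn : n = 2 ∨ n = 3)
    (Ω : Set (EuclideanSpace ℝ (Fin n)))
    (hΩo : IsOpen Ω) (hΩb : Bornology.IsBounded Ω) (hΩc : IsConnected Ω)
    (hcone : UniformIntConeProperty Ω)
    (m : ℕ) (hm : 0 < m) (hbl : BrokenLineCond Ω m)
    (A : Fin n → Fin n → EuclideanSpace ℝ (Fin n) → ℝ) (hA : EllipticSym Ω A)
    (Λ M η d₀ : ℝ) (hΛ : 0 < Λ) (hM : 0 < M) (hη : 0 < η) (hd₀ : 0 < d₀) :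
    ∃ c > 0, ∃ rs > 0, ∀ q u : EuclideanSpace ℝ (Fin n) → ℝ,
      Measurable q → (∀ᵐ x ∂(volume.restrict Ω), |q x| ≤ Λ) →
      ContDiffOn ℝ 2 u Ω → C1BoundOn Ω u M → IsSolution A q u Ω →
      (∀ x ∈ closure Ω, infDist x (frontier Ω) ≤ d₀ → η ≤ |u x|) →
      ∀ x ∈ closure Ω, ∀ r : ℝ, 0 < r → r ≤ rs →
        Real.exp (-(c * Real.exp (c / r))) ≤
          (∫ y in ball x r ∩ Ω, (u y) ^ 2) ^ (1 / 2 : ℝ) := by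
  have hne : Nonempty (Fin n) := ⟨⟨0, by omega⟩⟩
  have hcl : IsCompact (closure Ω) := hΩb.isCompact_closure
  have hfc : IsCompact (frontier Ω) := hcl.of_isClosed_subset isClosed_frontier frontier_subset_closure
  have hfn : (frontier Ω).Nonempty := by
    rw [nonempty_frontier_iff]
    refine ⟨hΩc.nonempty, fun h => ?_⟩
    rw [h] at hΩb
    exact NormedSpace.unbounded_univ ℝ (EuclideanSpace ℝ (Fin n)) hΩb
  set δ := d₀ / 16 with hδ
  have hδ0 : 0 < δ := by positivity
  obtain ⟨lam, hl, N, hN, hco⟩ := coef_bd hΩo hcl hA hδ0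
  obtain ⟨B, hB⟩ := hcl.isBounded.exists_norm_le
  set D := 2 * |B| + 1 with hD
  have hD0 : 0 < D := by positivity
  obtain ⟨c1, hc1, T, hT, p, hInt0⟩ := interior_est n hl hN hD0 hΛ hM hη hδ0
  obtain ⟨σ, hσ, R0, hR0, hin⟩ := inner_ball hΩo hfc hfn hcone
  obtain ⟨c2, hc2, p2, hnear⟩ := near_est hcl hη hσ
  obtain ⟨k1, hk1, hf1⟩ := final_exp hc1 hT p
  obtain ⟨k2, hk2, hf2⟩ := final_exp hc2 one_pos p2
  refine ⟨max k1 k2, by positivity, min (min δ 1) R0, by positivity, ?_⟩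
  intro q u hq hqb hu2 hu1 hsol hbd x hx r hr hrs
  have hrδ : r ≤ δ := hrs.trans ((min_le_left _ _).trans (min_le_left _ _))
  have hr1 : r ≤ 1 := hrs.trans ((min_le_left _ _).trans (min_le_right _ _))
  have hrR : r ≤ R0 := hrs.trans (min_le_right _ _)
  rcases le_or_gt (infDist x (frontier Ω)) (8 * δ) with hcase | hcase
  · obtain ⟨z, hz⟩ := hin x hx r hr hrR
    refine hf2 _ (le_max_right _ _) r hr _ (hnear u x z r hr hu1.1.continuousOn hΩo.measurableSet hz ?_)
    rintro y ⟨hy, hyΩ⟩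
    refine hbd y (subset_closure hyΩ) ?_
    have h1 := infDist_le_infDist_add_dist (s := frontier Ω) (x := y) (y := x)
    rw [mem_ball] at hy
    linarith
  · set R := infDist x (frontier Ω) with hR
    have hR0' : 0 < R := by linarith
    have hxΩ : x ∈ Ω := mem_of_infDist_pos hΩo hx hR0'
    have hsub : ball x R ⊆ Ω := ball_sub_dom hΩo hxΩ hR0' le_rfl
    obtain ⟨xt, hxt, hd⟩ := hfc.exists_infDist_eq_dist hfn x
    rw [← hR, dist_comm, dist_eq_norm] at hd
    have hRD : R ≤ D := by
      have h1 := hB x hx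
      have h2 := hB xt (frontier_subset_closure hxt)
      have h3 := norm_sub_le xt x
      have h4 := le_abs_self B
      linarith
    have hyΩ : ∀ y, ‖y - x‖ ≤ R - δ → y ∈ Ω := fun y hy => hsub (by
      rw [mem_ball, dist_eq_norm]; linarith)
    set y0 := x + ((R - 4 * δ) / R) • (xt - x) with hy0
    have e0 : y0 - x = ((R - 4 * δ) / R) • (xt - x) := by rw [hy0]; abel
    have hq0 : 0 ≤ (R - 4 * δ) / R := div_nonneg (by linarith) hR0'.le
    have hy0n : ‖y0 - x‖ = R - 4 * δ := by
      rw [e0, norm_smul, ← hd, Real.norm_of_nonneg hq0]; field_simp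
    have e1 : xt - y0 = (4 * δ / R) • (xt - x) := by
      have : (4 * δ / R) = 1 - (R - 4 * δ) / R := by field_simp; ring
      rw [this, sub_smul, one_smul, ← e0]; abel
    have hy0t : ‖xt - y0‖ = 4 * δ := by
      rw [e1, norm_smul, ← hd, Real.norm_of_nonneg (by positivity)]; field_simp
    have hbr : ball x r ∩ Ω = ball x r :=
      inter_eq_left.2 ((ball_subset_ball (by linarith)).trans hsub)
    rw [hbr]
    refine hf1 _ (le_max_left _ _) r hr _
      (hInt0 A u x y0 R r hcase.le hRD hr hrδ hr1 ?_ ?_ hy0n ?_)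
    · intro y hy
      have hyO := hyΩ y hy
      refine ⟨hco y hyO ?_, hu2.contDiffAt (hΩo.mem_nhds hyO), hu1.2.1 y (subset_closure hyO),
        hu1.2.2 y hyO⟩
      have h1 := infDist_le_infDist_add_dist (s := frontier Ω) (x := x) (y := y)
      rw [← hR, dist_comm, dist_eq_norm] at h1
      linarith
    · have h1 := (ae_restrict_iff' hΩo.measurableSet).1 hqb
      filter_upwards [h1] with y hy hyn
      have hyO := hyΩ y hyn
      have h2 := hsol y hyO
      have h3 : Lop A u y = -(q y * u y) := by
        unfold Lop; linarith
      rw [h3, abs_neg, abs_mul]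
      exact mul_le_mul_of_nonneg_right (hy hyO) (abs_nonneg _)
    · intro y hy
      rw [mem_ball, dist_eq_norm] at hy
      have hyO : y ∈ Ω := hyΩ y (by
        have e : y - x = (y - y0) + (y0 - x) := by abel
        have n1 := norm_add_le (y - y0) (y0 - x)
        rw [← e] at n1
        linarith)
      refine hbd y (subset_closure hyO) ?_
      have h1 := infDist_le_dist_of_mem hxt (x := y)
      have h2 : dist y xt ≤ ‖y - y0‖ + ‖xt - y0‖ := by
        rw [← dist_eq_norm, ← dist_eq_norm, dist_comm xt y0]; exact dist_triangle _ _ _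
      linarith
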